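/- arXiv:math/0402379 — 2 statements merged into one kernel-verified Lean document; each statement's English description precedes it below -/
import Mathlib

section
/- There exists a 2π-periodic C^∞ function f: R → R belonging to the quasianalytic class C^#{(j log j)^j} on [0,2π] such that f coincides with any real analytic function in at most a discrete set: for every open interval I and every real analytic function g: I → R, the set {x ∈ I : f(x) = g(x)} has no accumulation point in I. -/
open Set Filter Topology

noncomputable section

/-- `f` belongs to the class `C^#{M_j}` on `[a,b]`: there is a constant `C > 0`
with `sup_{[a,b]} |f^{(j)}| ≤ C^j M_j` for all `j ≥ 1`. -/
def MemCSharp (M : ℕ → ℝ) (f : ℝ → ℝ) (a b : ℝ) : Prop :=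
  ∃ C > 0, ∀ j : ℕ, 1 ≤ j → ∀ x ∈ Set.Icc a b, |iteratedDeriv j f x| ≤ C ^ j * M j

/-- `M` is an admissible version of the sequence `M^{(k)}_j = (j log_k j)^j`
(where `log_k` is the `k`-th iterated logarithm): positive, increasing,
logarithmically convex, and equal to `(j log_k j)^j` for all sufficiently
large `j`. -/
def IsMkSeq (k : ℕ) (M : ℕ → ℝ) : Prop :=
  (∀ j, 0 < M j) ∧ Monotone M ∧
  (∀ j : ℕ, M (j + 1) ^ 2 ≤ M j * M (j + 2)) ∧
  ∃ J : ℕ, ∀ j ≥ J, M j = ((j : ℝ) * Real.log^[k] j) ^ j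

namespace QA

/-- the log of the weight sequence -/
def hh (x : ℝ) : ℝ := x * (Real.log x + Real.log (Real.log x))

def hh' (x : ℝ) : ℝ := Real.log x + Real.log (Real.log x) + 1 + (Real.log x)⁻¹

def hh'' (x : ℝ) : ℝ := x⁻¹ + x⁻¹ / Real.log x - x⁻¹ / (Real.log x) ^ 2

lemma hh_deriv (x : ℝ) (hx : 1 < x) : HasDerivAt hh (hh' x) x := by
  have hl : 0 < Real.log x := Real.log_pos hx
  have h1 : HasDerivAt Real.log x⁻¹ x := Real.hasDerivAt_log (by linarith)
  have h2 := h1.log hl.ne'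
  have h3 : HasDerivAt hh _ x := (hasDerivAt_id x).mul (h1.add h2)
  refine h3.congr_deriv ?_
  simp only [hh', id]
  field_simp
  ring

lemma hh'_deriv (x : ℝ) (hx : 1 < x) : HasDerivAt hh' (hh'' x) x := by
  have hl : 0 < Real.log x := Real.log_pos hx
  have h1 : HasDerivAt Real.log x⁻¹ x := Real.hasDerivAt_log (by linarith)
  have h2 := h1.log hl.ne'
  have h3 : HasDerivAt hh' _ x := ((h1.add h2).add_const 1).add (h1.inv hl.ne')
  refine h3.congr_deriv ?_
  simp only [hh'']
  ring

lemma hh''_nonneg (x : ℝ) (hx : 2 < x) : 0 ≤ hh'' x := by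
  have hl : Real.log 2 < Real.log x := Real.log_lt_log (by norm_num) hx
  have h2 := Real.log_two_gt_d9
  have : hh'' x = (x⁻¹ / (Real.log x) ^ 2) * ((Real.log x) ^ 2 + Real.log x - 1) := by
    have : 0 < Real.log x := by linarith
    simp only [hh'']
    field_simp
  rw [this]
  apply mul_nonneg
  · positivity
  · nlinarith

lemma hh_convex : ConvexOn ℝ (Ici 2) hh := by
  apply convexOn_of_hasDerivWithinAt2_nonneg (f' := hh') (f'' := hh'') (convex_Ici 2)
  · intro x hx
    exact (hh_deriv x (by have := mem_Ici.1 hx; linarith)).continuousAt.continuousWithinAt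
  · intro x hx
    rw [interior_Ici] at hx
    exact (hh_deriv x (by have := mem_Ioi.1 hx; linarith)).hasDerivWithinAt
  · intro x hx
    rw [interior_Ici] at hx
    exact (hh'_deriv x (by have := mem_Ioi.1 hx; linarith)).hasDerivWithinAt
  · intro x hx
    rw [interior_Ici] at hx
    exact hh''_nonneg x hx

def MM (j : ℕ) : ℝ := if j = 0 then 1/4 else if j = 1 then 1/2 else ((j:ℝ) * Real.log j) ^ j

lemma MM_two (j : ℕ) (hj : 2 ≤ j) : MM j = ((j:ℝ) * Real.log j) ^ j := by
  unfold MM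
  rw [if_neg (by omega), if_neg (by omega)]

lemma base_ge (j : ℕ) (hj : 2 ≤ j) : 1 ≤ (j:ℝ) * Real.log j := by
  have h2 := Real.log_two_gt_d9
  have hj' : (2:ℝ) ≤ j := by exact_mod_cast hj
  have hl : Real.log 2 ≤ Real.log j := Real.log_le_log (by norm_num) hj'
  nlinarith

lemma MM_exp (j : ℕ) (hj : 2 ≤ j) : MM j = Real.exp (hh j) := by
  have hj' : (2:ℝ) ≤ j := by exact_mod_cast hj
  have hl : 0 < Real.log j := Real.log_pos (by linarith)
  rw [MM_two j hj, hh, Real.exp_nat_mul, Real.exp_add, Real.exp_log (by linarith), Real.exp_log hl]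

lemma MM_pos (j : ℕ) : 0 < MM j := by
  by_cases hj : 2 ≤ j
  · rw [MM_exp j hj]; positivity
  · interval_cases j <;> norm_num [MM]

lemma MM2_ge : 1 ≤ MM 2 := by
  rw [MM_two 2 le_rfl]; exact one_le_pow₀ (base_ge 2 le_rfl)

lemma MM_mono : Monotone MM := by
  apply monotone_nat_of_le_succ
  intro j
  by_cases hj : 2 ≤ j
  · rw [MM_two j hj, MM_two (j+1) (by omega)]
    have h1 := base_ge j hj
    have hj' : (2:ℝ) ≤ j := by exact_mod_cast hj
    have hl : 0 < Real.log j := Real.log_pos (by linarith)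
    have h2 : (j:ℝ) * Real.log j ≤ ((j+1:ℕ):ℝ) * Real.log ((j+1:ℕ):ℝ) := by
      push_cast
      gcongr <;> linarith
    calc _ ≤ ((j:ℝ) * Real.log j) ^ (j+1) := pow_le_pow_right₀ h1 (by omega)
      _ ≤ _ := pow_le_pow_left₀ (by linarith) h2 _
  · have := MM2_ge
    interval_cases j
    · norm_num [MM]
    · have h : MM 1 = 1/2 := by norm_num [MM]
      norm_num [h]; linarith

lemma MM_logconv (j : ℕ) : MM (j+1) ^ 2 ≤ MM j * MM (j+2) := by
  by_cases hj : 2 ≤ j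
  · rw [MM_exp j hj, MM_exp (j+1) (by omega), MM_exp (j+2) (by omega), ← Real.exp_add,
      ← Real.exp_nat_mul]
    apply Real.exp_le_exp.2
    have hj' : (2:ℝ) ≤ j := by exact_mod_cast hj
    have hy : (j:ℝ) + 2 ∈ Ici (2:ℝ) := mem_Ici.2 (by linarith)
    have := hh_convex.2 (mem_Ici.2 hj') hy
      (show (0:ℝ) ≤ 1/2 by norm_num) (show (0:ℝ) ≤ 1/2 by norm_num) (by norm_num)
    simp only [smul_eq_mul] at this
    rw [show 1 / 2 * (j:ℝ) + 1 / 2 * ((j:ℝ) + 2) = j + 1 by ring] at this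
    push_cast
    linarith
  · have h2 := MM2_ge
    have h0 : MM 0 = 1/4 := by norm_num [MM]
    have h1 : MM 1 = 1/2 := by norm_num [MM]
    interval_cases j
    · norm_num [h0, h1]; linarith
    · norm_num [h1]
      rw [MM_two 2 le_rfl, MM_two 3 (by norm_num)]
      have hl := Real.log_two_lt_d9
      have hl' := Real.log_two_gt_d9
      have h3 : 1 ≤ Real.log 3 := by
        rw [Real.le_log_iff_exp_le (by norm_num)]
        have := Real.exp_one_lt_d9; linarith
      have a1 : ((2:ℕ):ℝ) * Real.log (2:ℕ) ≤ 1.5 := by push_cast; linarith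
      have a2 : 3 ≤ ((3:ℕ):ℝ) * Real.log (3:ℕ)  := by push_cast; linarith
      have a3 := pow_le_pow_left₀ (by norm_num) a2 3
      have a0 : 0 ≤ ((2:ℕ):ℝ) * Real.log (2:ℕ) := by push_cast; linarith
      have a4 := pow_le_pow_left₀ a0 a1 4
      rw [← pow_mul]
      norm_num at a3 a4 ⊢
      linarith



def pp (k : ℕ) : ℕ := 16 ^ (k+1)
def NN (k : ℕ) : ℝ := (pp k : ℝ) * 2 ^ pp k
def aa (k : ℕ) : ℝ := Real.exp (-(2:ℝ) ^ pp k)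
def TT (j k : ℕ) : ℝ := aa k * NN k ^ j
def FF (j : ℕ) (x : ℝ) : ℝ := ∑' k, TT j k * Real.cos (NN k * x + j * (Real.pi / 2))

lemma pp_ge (k : ℕ) : 16 ≤ pp k := by
  unfold pp
  calc 16 = 16 ^ 1 := by norm_num
    _ ≤ _ := Nat.pow_le_pow_right (by norm_num) (by omega)

lemma lt_pp (k : ℕ) : k < pp k := by
  unfold pp
  exact (Nat.lt_succ_self k).trans (Nat.lt_pow_self (by norm_num))

lemma NN_ge (k : ℕ) : 16 ≤ NN k := by
  unfold NN
  have h : (16:ℝ) ≤ pp k := by exact_mod_cast pp_ge k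
  have h2 : (1:ℝ) ≤ 2 ^ pp k := one_le_pow₀ (by norm_num)
  nlinarith

lemma pp_mul {k l : ℕ} (h : k < l) : 16 * pp k ≤ pp l := by
  unfold pp
  calc 16 * 16 ^ (k+1) = 16 ^ (k+1+1) := by ring
    _ ≤ _ := Nat.pow_le_pow_right (by norm_num) (by omega)

lemma TT_nonneg (j k : ℕ) : 0 ≤ TT j k := by
  have := NN_ge k
  unfold TT aa; positivity

lemma key_base (p j : ℕ) (hj : 2 ≤ j) :
    (p:ℝ) * 2 ^ p ≤ 18 * (j * Real.log j) * Real.exp ((2:ℝ) ^ p / j / 2) := by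
  have hj' : (2:ℝ) ≤ j := by exact_mod_cast hj
  have hl2 := Real.log_two_gt_d9
  have hL : Real.log 2 ≤ Real.log j := Real.log_le_log (by norm_num) hj'
  set L := Real.log j with hLdef
  set x : ℝ := (2:ℝ) ^ p with hx
  have hx0 : 0 < x := by positivity
  set u := x / j with hu
  have hu0 : 0 < u := by positivity
  have hxu : x = j * u := by rw [hu]; field_simp
  have h1 : (p:ℝ) * Real.log 2 ≤ L + u := by
    have : Real.log x = p * Real.log 2 := by rw [hx, Real.log_pow]
    rw [← this, hxu, Real.log_mul (by positivity) hu0.ne']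
    have := Real.log_le_sub_one_of_pos hu0
    linarith
  have h2 := Real.quadratic_le_exp_of_nonneg (x := u/2) (by positivity)
  have h3 : (p:ℝ) ≤ 3/2 * (L + u) := by
    have : (0:ℝ) ≤ p := by positivity
    nlinarith
  have h4 : u ≤ 3/2 * (L * u) := by nlinarith
  have h5 : (p:ℝ) ≤ 3/2 * L * (1 + 3/2 * u) := by nlinarith
  have hjL : 0 ≤ j * L := by apply mul_nonneg <;> linarith
  calc (p:ℝ) * x ≤ (3/2 * L * (1 + 3/2 * u)) * x := by gcongr
    _ = (j * L) * (3/2 * u + 9/4 * u^2) := by rw [hxu]; ring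
    _ ≤ (j * L) * (18 * Real.exp (u/2)) := by
        apply mul_le_mul_of_nonneg_left _ hjL
        nlinarith
    _ = _ := by ring

lemma TT_le (j k : ℕ) (hj : 2 ≤ j) :
    TT j k ≤ (18 * (j * Real.log j)) ^ j * Real.exp (-1/2) ^ k := by
  have hj' : (2:ℝ) ≤ j := by exact_mod_cast hj
  have hL : 0 < Real.log j := Real.log_pos (by linarith)
  have h := key_base (pp k) j hj
  have h0 : 0 ≤ NN k := by linarith [NN_ge k]
  have hk : (k:ℝ) ≤ 2 ^ pp k := by
    have : k ≤ 2 ^ pp k := (lt_pp k).le.trans (Nat.lt_two_pow_self).le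
    exact_mod_cast this
  have h2 := pow_le_pow_left₀ h0 h j
  rw [mul_pow, ← Real.exp_nat_mul] at h2
  have e : (j:ℝ) * ((2:ℝ) ^ pp k / j / 2) = 2 ^ pp k / 2 := by field_simp
  rw [e] at h2
  unfold TT aa
  calc _ ≤ Real.exp (-(2:ℝ) ^ pp k) * ((18 * (j * Real.log j)) ^ j * Real.exp (2 ^ pp k / 2)) := by
        gcongr
    _ = (18 * (j * Real.log j)) ^ j * Real.exp (-(2:ℝ) ^ pp k / 2) := by
        rw [mul_left_comm, ← Real.exp_add]; congr 2; ring
    _ ≤ _ := by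
        rw [← Real.exp_nat_mul]
        gcongr
        linarith

lemma geo : Summable fun k : ℕ => Real.exp (-1/2) ^ k := by
  apply summable_geometric_of_lt_one (by positivity)
  rw [Real.exp_lt_one_iff]; norm_num

lemma TT_summable (j : ℕ) : Summable (TT j) := by
  have h : ∀ j, 2 ≤ j → Summable (TT j) := fun j hj =>
    Summable.of_nonneg_of_le (TT_nonneg j) (fun k => TT_le j k hj) (geo.mul_left _)
  refine Summable.of_nonneg_of_le (TT_nonneg j) (fun k => ?_) (h (j+2) (by omega))
  unfold TT
  have := NN_ge k
  have h1 : NN k ^ j ≤ NN k ^ (j+2) := pow_le_pow_right₀ (by linarith) (by omega)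
  exact mul_le_mul_of_nonneg_left h1 (Real.exp_pos _).le

lemma term_le (j k : ℕ) (y : ℝ) : ‖TT j k * Real.cos y‖ ≤ TT j k := by
  rw [norm_mul, Real.norm_of_nonneg (TT_nonneg j k)]
  exact mul_le_of_le_one_right (TT_nonneg j k) (Real.abs_cos_le_one y)

lemma FF_summable (j : ℕ) (x : ℝ) :
    Summable fun k => TT j k * Real.cos (NN k * x + j * (Real.pi / 2)) :=
  Summable.of_norm_bounded (TT_summable j) (fun k => term_le j k _)

lemma FF_deriv (j : ℕ) (x : ℝ) : HasDerivAt (FF j) (FF (j+1) x) x := by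
  unfold FF
  refine hasDerivAt_tsum (g := fun k z => TT j k * Real.cos (NN k * z + j * (Real.pi / 2)))
    (g' := fun k z => TT (j+1) k * Real.cos (NN k * z + (j+1:ℕ) * (Real.pi / 2)))
    (TT_summable (j+1)) (fun k y => ?_) (fun k y => term_le (j+1) k _) (FF_summable j 0) x
  have h1 : HasDerivAt (fun z => NN k * z + j * (Real.pi / 2)) (NN k) y := by
    simpa using ((hasDerivAt_id y).const_mul (NN k)).add_const (j * (Real.pi / 2))
  refine (h1.cos.const_mul (TT j k)).congr_deriv ?_
  rw [show NN k * y + ((j+1:ℕ):ℝ) * (Real.pi / 2) = (NN k * y + j * (Real.pi / 2)) + Real.pi / 2 by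
    push_cast; ring, Real.cos_add_pi_div_two]
  unfold TT
  ring

lemma FF_iter (j : ℕ) : iteratedDeriv j (FF 0) = FF j := by
  induction j with
  | zero => simp
  | succ j ih =>
    rw [iteratedDeriv_succ, ih]
    ext x
    exact (FF_deriv j x).deriv

lemma FF_contDiff : ContDiff ℝ (⊤ : ℕ∞) (FF 0) := by
  apply contDiff_of_differentiable_iteratedDeriv
  intro m _
  rw [FF_iter]
  exact fun x => (FF_deriv m x).differentiableAt

lemma FF_periodic : Function.Periodic (FF 0) (2 * Real.pi) := by
  intro x
  unfold FF
  congr 1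
  ext k
  congr 1
  have : NN k * (x + 2 * Real.pi) + (0:ℕ) * (Real.pi / 2)
    = (NN k * x + (0:ℕ) * (Real.pi / 2)) + ((pp k * 2 ^ pp k : ℕ) : ℝ) * (2 * Real.pi) := by
    unfold NN; push_cast; ring
  rw [this, Real.cos_add_nat_mul_two_pi]

lemma FF_abs_le (j : ℕ) (x : ℝ) : |FF j x| ≤ ∑' k, TT j k := by
  exact tsum_of_norm_bounded (TT_summable j).hasSum (fun k => term_le j k _)

lemma rolle_step (u v : ℝ → ℝ) (s : Set ℝ) (hs : IsOpen s) (hd : ∀ x ∈ s, HasDerivAt u (v x) x)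
    (t : ℝ) (ht : t ∈ s) (hf : ∃ᶠ x in 𝓝[≠] t, u x = 0) : u t = 0 ∧ ∃ᶠ x in 𝓝[≠] t, v x = 0 := by
  have h0 : u t = 0 := by
    by_contra hne
    have h1 : ∀ᶠ x in 𝓝[≠] t, u x ≠ 0 :=
      ((hd t ht).continuousAt.eventually_ne hne).filter_mono nhdsWithin_le_nhds
    obtain ⟨x, hx, hx'⟩ := (hf.and_eventually h1).exists
    exact hx' hx
  refine ⟨h0, ?_⟩
  rw [Filter.frequently_iff]
  intro W hW
  rw [mem_nhdsWithin_iff_exists_mem_nhds_inter] at hW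
  obtain ⟨V, hV, hVW⟩ := hW
  obtain ⟨ε, hε, hb⟩ := Metric.mem_nhds_iff.1 (inter_mem hV (hs.mem_nhds ht))
  have h2 : ∀ᶠ x in 𝓝[≠] t, x ∈ Metric.ball t ε ∧ x ≠ t :=
    (Filter.Eventually.filter_mono nhdsWithin_le_nhds (Metric.ball_mem_nhds t hε)).and
      self_mem_nhdsWithin
  obtain ⟨x, hx, hxb, hxt⟩ := (hf.and_eventually h2).exists
  have hconv : Convex ℝ (Metric.ball t ε) := convex_ball t ε
  have htb : t ∈ Metric.ball t ε := Metric.mem_ball_self hε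
  have main : ∀ a b : ℝ, a < b → a ∈ Metric.ball t ε → b ∈ Metric.ball t ε → u a = 0 → u b = 0 →
      ∃ c ∈ Ioo a b, c ∈ Metric.ball t ε ∧ v c = 0 := by
    intro a b hab ha hb' ua ub
    have hsub : Icc a b ⊆ Metric.ball t ε := hconv.ordConnected.out ha hb'
    have hd' : ∀ y ∈ Icc a b, HasDerivAt u (v y) y := fun y hy => hd y (hb (hsub hy)).2
    obtain ⟨c, hc, hc'⟩ := exists_hasDerivAt_eq_zero hab
      (fun y hy => (hd' y hy).continuousAt.continuousWithinAt) (by rw [ua, ub])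
      (fun y hy => hd' y (Ioo_subset_Icc_self hy))
    exact ⟨c, hc, hsub (Ioo_subset_Icc_self hc), hc'⟩
  rcases lt_or_gt_of_ne hxt with h | h
  · obtain ⟨c, hc, hcb, hc'⟩ := main x t h hxb htb hx h0
    exact ⟨c, hVW ⟨(hb hcb).1, hc.2.ne⟩, hc'⟩
  · obtain ⟨c, hc, hcb, hc'⟩ := main t x h htb hxb h0 hx
    exact ⟨c, hVW ⟨(hb hcb).1, hc.1.ne'⟩, hc'⟩

lemma eq_derivs (g : ℝ → ℝ) (s : Set ℝ) (hs : IsOpen s) (hg : AnalyticOnNhd ℝ g s) (t : ℝ)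
    (ht : t ∈ s) (hf : ∃ᶠ x in 𝓝[≠] t, FF 0 x = g x) (j : ℕ) : FF j t = iteratedDeriv j g t := by
  have hstep : ∀ j, ∀ x ∈ s, HasDerivAt (fun x => FF j x - iteratedDeriv j g x)
      (FF (j+1) x - iteratedDeriv (j+1) g x) x := by
    intro j x hx
    refine (FF_deriv j x).sub ?_
    have := (hg.iterated_deriv j x hx).differentiableAt.hasDerivAt
    rw [← iteratedDeriv_eq_iterate] at this
    rwa [iteratedDeriv_succ]
  have hfr : ∀ j, ∃ᶠ x in 𝓝[≠] t, FF j x - iteratedDeriv j g x = 0 := by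
    intro j
    induction j with
    | zero => simpa [sub_eq_zero] using hf
    | succ j ih => exact (rolle_step _ _ s hs (hstep j) t ht ih).2
  exact sub_eq_zero.1 (rolle_step _ _ s hs (hstep j) t ht (hfr j)).1

lemma analytic_bound (g : ℝ → ℝ) (t : ℝ) (hg : AnalyticAt ℝ g t) :
    ∃ B : ℝ, 1 ≤ B ∧ ∀ j : ℕ, 1 ≤ j → |iteratedDeriv j g t| ≤ (B * j) ^ j := by
  obtain ⟨p, r, hp⟩ := hg
  obtain ⟨r', hr0, hr'⟩ := ENNReal.lt_iff_exists_nnreal_btwn.1 (hp.r_pos.trans_le hp.r_le)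
  obtain ⟨C, hC, hb⟩ := p.norm_mul_pow_le_of_lt_radius hr'
  have hr0' : (0:ℝ) < r' := by exact_mod_cast hr0
  refine ⟨max 1 C * max 1 (r':ℝ)⁻¹, ?_, ?_⟩
  · exact one_le_mul_of_one_le_of_one_le (le_max_left _ _) (le_max_left _ _)
  · intro j hj
    rw [iteratedDeriv_eq_iteratedFDeriv, ← hp.factorial_smul]
    have h1 : ‖p j (fun _ => (1:ℝ))‖ ≤ ‖p j‖ := by
      simp
    have h2 : ‖p j‖ ≤ C * (r':ℝ)⁻¹ ^ j := by
      rw [inv_pow, ← div_eq_mul_inv, le_div_iff₀ (by positivity)]; exact hb j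
    have h3 : (j.factorial : ℝ) ≤ (j:ℝ) ^ j := by exact_mod_cast Nat.factorial_le_pow j
    have h4 : C ≤ max 1 C ^ j := (le_max_right 1 C).trans (le_self_pow₀ (le_max_left _ _) (by omega))
    rw [nsmul_eq_mul, abs_mul, Nat.abs_cast]
    calc _ ≤ (j:ℝ) ^ j * (max 1 C ^ j * max 1 (r':ℝ)⁻¹ ^ j) := by
          apply mul_le_mul h3 _ (abs_nonneg _) (by positivity)
          refine (h1.trans h2).trans ?_
          gcongr
          exact le_max_right _ _
      _ = _ := by rw [mul_pow, mul_pow]; ring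

lemma TT_other (k l j : ℕ) (hkl : l ≠ k) (hj1 : 2 ^ pp k ≤ j) (hj2 : j ≤ 2 ^ pp k + 1) :
    TT j l ≤ (1/16) * (NN k / Real.exp 1) ^ j * (1/2) ^ l := by
  have he1 : (2:ℝ) ≤ Real.exp 1 := by have := Real.exp_one_gt_d9; linarith
  have he3 : Real.exp 1 ≤ 3 := by have := Real.exp_one_lt_d9; linarith
  have hee : Real.exp (-1) ≤ 1/2 := by
    rw [Real.exp_neg, ← one_div]; exact one_div_le_one_div_of_le (by norm_num) he1
  have hN := NN_ge k
  have hNl := NN_ge l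
  have hj : 1 ≤ j := le_trans Nat.one_le_two_pow hj1
  rcases lt_or_gt_of_ne hkl with h | h
  · have hp := pp_mul h
    have hl := pp_ge l
    have h1 : 48 * NN l ≤ NN k := by
      unfold NN
      have e1 : (2:ℝ) ^ (pp l + 6) ≤ 2 ^ pp k := pow_le_pow_right₀ (by norm_num) (by omega)
      have e2 : (pp l : ℝ) ≤ pp k := by exact_mod_cast (by omega : pp l ≤ pp k)
      have e3 : 48 * (2:ℝ) ^ pp l ≤ 2 ^ pp k := by
        rw [pow_add] at e1
        have : (0:ℝ) < 2 ^ pp l := by positivity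
        linarith
      calc 48 * ((pp l : ℝ) * 2 ^ pp l) = pp l * (48 * 2 ^ pp l) := by ring
        _ ≤ pp k * 2 ^ pp k := by gcongr
    have h2 : NN l ≤ (1/16) * (NN k / Real.exp 1) := by
      have : NN k / 3 ≤ NN k / Real.exp 1 := by gcongr
      linarith
    have h3 : NN l ^ j ≤ (1/16) * (NN k / Real.exp 1) ^ j := by
      refine (pow_le_pow_left₀ (by linarith) h2 j).trans ?_
      rw [mul_pow]
      gcongr
      exact pow_le_of_le_one (by norm_num) (by norm_num) (by omega)
    have h4 : aa l ≤ (1/2) ^ l := by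
      have : (l:ℝ) ≤ 2 ^ pp l := by
        exact_mod_cast ((lt_pp l).le.trans (Nat.lt_two_pow_self).le : l ≤ 2 ^ pp l)
      calc aa l ≤ Real.exp (l * (-1)) := by unfold aa; gcongr; linarith
        _ = Real.exp (-1) ^ l := Real.exp_nat_mul _ _
        _ ≤ _ := by gcongr
    unfold TT
    rw [mul_comm]
    exact mul_le_mul h3 h4 (Real.exp_pos _).le (by positivity)
  · have hp := pp_mul h
    have hk := pp_ge k
    have hlp := lt_pp l
    have h1 : 1 ≤ (NN k / Real.exp 1) ^ j := by
      apply one_le_pow₀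
      rw [one_le_div (by positivity)]; linarith
    have h2 : NN l ≤ Real.exp 1 ^ (2 * pp l) := by
      have : (pp l : ℝ) ≤ 2 ^ pp l := by exact_mod_cast (Nat.lt_two_pow_self).le
      calc NN l ≤ 2 ^ pp l * 2 ^ pp l := by unfold NN; gcongr
        _ = 2 ^ (2 * pp l) := by rw [← pow_add]; congr 1; ring
        _ ≤ _ := by gcongr
    have h3 : 2 * pp l * j + (l + 4) ≤ 2 ^ pp l := by
      have hj3 : j ≤ 2 ^ (pp k + 1) := by
        rw [pow_succ]; have := Nat.one_le_two_pow (n := pp k); omega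
      obtain ⟨r, hr⟩ : ∃ r, pp l = 16 * r := ⟨16 ^ l, by unfold pp; ring⟩
      have hrk : pp k ≤ r := by omega
      have hr2 : r < 2 ^ r := Nat.lt_two_pow_self
      have hj4 : j ≤ 2 ^ (r + 1) := hj3.trans (Nat.pow_le_pow_right (by norm_num) (by omega))
      have hj5 : 2 ≤ 2 ^ (r+1) := by
        rw [pow_succ]; have := Nat.one_le_two_pow (n := r); omega
      calc 2 * pp l * j + (l + 4) ≤ 2 * pp l * 2 ^ (r+1) + pp l * 2 := by
            have := Nat.mul_le_mul_left (2 * pp l) hj4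
            omega
        _ ≤ 2 * pp l * 2 ^ (r+1) + pp l * 2 ^ (r+1) := by
            have := Nat.mul_le_mul_left (pp l) hj5
            omega
        _ = 48 * r * 2 ^ (r+1) := by rw [hr]; ring
        _ ≤ 48 * 2 ^ r * 2 ^ (r+1) := by gcongr
        _ ≤ 2 ^ 6 * 2 ^ r * 2 ^ (r+1) := by gcongr; norm_num
        _ = 2 ^ (6 + r + (r+1)) := by rw [← pow_add, ← pow_add]
        _ ≤ 2 ^ pp l := Nat.pow_le_pow_right (by norm_num) (by omega)
    have h3' : ((2 * pp l * j : ℕ) : ℝ) + ((l + 4 : ℕ):ℝ) ≤ 2 ^ pp l := by exact_mod_cast h3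
    have h4 : TT j l ≤ (1/16) * (1/2) ^ l := by
      unfold TT aa
      calc _ ≤ Real.exp (-(2:ℝ) ^ pp l) * (Real.exp 1 ^ (2 * pp l)) ^ j := by gcongr
        _ = Real.exp (-(2:ℝ) ^ pp l + (2 * pp l * j : ℕ)) := by
            rw [← pow_mul, ← Real.exp_nat_mul, ← Real.exp_add, mul_one]
        _ ≤ Real.exp ((l + 4 : ℕ) * (-1)) := by gcongr; linarith
        _ = Real.exp (-1) ^ (l + 4) := Real.exp_nat_mul _ _
        _ ≤ (1/2) ^ (l+4) := by gcongr
        _ = _ := by rw [pow_add]; ring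
    refine h4.trans ?_
    have : (0:ℝ) < (1/2) ^ l := by positivity
    nlinarith

lemma TT_self (k j : ℕ) (hj1 : 2 ^ pp k ≤ j) : (NN k / Real.exp 1) ^ j ≤ TT j k := by
  have hN := NN_ge k
  have hj : (2:ℝ) ^ pp k ≤ j := by exact_mod_cast hj1
  unfold TT aa
  rw [div_pow, div_eq_mul_inv, mul_comm, ← Real.exp_nat_mul, ← Real.exp_neg]
  gcongr
  linarith

lemma FF_lower_aux (k j : ℕ) (t : ℝ) (hj1 : 2 ^ pp k ≤ j) (hj2 : j ≤ 2 ^ pp k + 1)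
    (hc : 1/2 ≤ |Real.cos (NN k * t + j * (Real.pi / 2))|) :
    (1/4) * (NN k / Real.exp 1) ^ j ≤ |FF j t| := by
  have hN := NN_ge k
  have hpos : 0 ≤ (NN k / Real.exp 1) ^ j := by positivity
  have h1 := (FF_summable j t).tsum_eq_add_tsum_ite k
  have h2 : |∑' n, if n = k then 0 else TT j n * Real.cos (NN n * t + j * (Real.pi / 2))|
      ≤ (1/16) * (NN k / Real.exp 1) ^ j * 2 := by
    rw [← Real.norm_eq_abs]
    refine tsum_of_norm_bounded (hasSum_geometric_two.mul_left _) (fun n => ?_)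
    by_cases hn : n = k
    · rw [if_pos hn, norm_zero]; positivity
    · rw [if_neg hn]
      exact (term_le j n _).trans (TT_other k n j hn hj1 hj2)
  have h3 : (1/2) * (NN k / Real.exp 1) ^ j
      ≤ |TT j k * Real.cos (NN k * t + j * (Real.pi / 2))| := by
    rw [abs_mul, abs_of_nonneg (TT_nonneg j k), mul_comm]
    exact mul_le_mul (TT_self k j hj1) hc (by norm_num) (TT_nonneg j k)
  unfold FF
  rw [h1]
  have h4 := abs_sub_abs_le_abs_sub (TT j k * Real.cos (NN k * t + j * (Real.pi / 2)))
    (-∑' n, if n = k then 0 else TT j n * Real.cos (NN n * t + j * (Real.pi / 2)))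
  rw [abs_neg, sub_neg_eq_add] at h4
  linarith

lemma FF_lower (k : ℕ) (t : ℝ) : ∃ j : ℕ, 2 ^ pp k ≤ j ∧ j ≤ 2 ^ pp k + 1 ∧
    (1/4) * (NN k / Real.exp 1) ^ j ≤ |FF j t| := by
  by_cases h : 1/2 ≤ |Real.cos (NN k * t + (2 ^ pp k : ℕ) * (Real.pi / 2))|
  · exact ⟨_, le_rfl, by omega, FF_lower_aux k _ t le_rfl (by omega) h⟩
  · refine ⟨2 ^ pp k + 1, by omega, le_rfl, FF_lower_aux k _ t (by omega) le_rfl ?_⟩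
    set θ := NN k * t + (2 ^ pp k : ℕ) * (Real.pi / 2) with hθ
    rw [show NN k * t + ((2 ^ pp k + 1 : ℕ) : ℝ) * (Real.pi / 2) = θ + Real.pi / 2 by
      rw [hθ]; push_cast; ring, Real.cos_add_pi_div_two, abs_neg]
    by_contra h'
    have h1 := Real.sin_sq_add_cos_sq θ
    rw [← sq_abs (Real.sin θ), ← sq_abs (Real.cos θ)] at h1
    have a1 := abs_nonneg (Real.sin θ)
    have a2 := abs_nonneg (Real.cos θ)
    push Not at h h'
    nlinarith

lemma no_bound (t B : ℝ) (hB : 1 ≤ B) (h : ∀ j : ℕ, 1 ≤ j → |FF j t| ≤ (B * j) ^ j) : False := by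
  obtain ⟨k, hk⟩ := exists_nat_gt (24 * B)
  obtain ⟨j, hj1, hj2, hl⟩ := FF_lower k t
  have hj : 1 ≤ j := le_trans Nat.one_le_two_pow hj1
  have hu := h j hj
  have he3 : Real.exp 1 ≤ 3 := by have := Real.exp_one_lt_d9; linarith
  have hpk : (k:ℝ) < pp k := by exact_mod_cast lt_pp k
  have hj0 : (1:ℝ) ≤ j := by exact_mod_cast hj
  have hj3 : (j:ℝ) ≤ 2 * 2 ^ pp k := by
    have := Nat.one_le_two_pow (n := pp k)
    exact_mod_cast (by omega : j ≤ 2 * 2 ^ pp k)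
  have h1 : 4 * (B * j) < NN k / Real.exp 1 := by
    rw [lt_div_iff₀ (by positivity)]
    unfold NN
    have : 4 * (B * j) * Real.exp 1 ≤ 4 * (B * j) * 3 := by gcongr
    have h2 : 4 * (B * j) * 3 ≤ 4 * (B * (2 * 2 ^ pp k)) * 3 := by gcongr
    have h3 : (0:ℝ) < 2 ^ pp k := by positivity
    nlinarith
  have h2 : (4 * (B * j)) ^ j < (NN k / Real.exp 1) ^ j :=
    pow_lt_pow_left₀ h1 (by positivity) (by omega)
  rw [mul_pow] at h2
  have h3 : (4:ℝ) ≤ 4 ^ j := le_self_pow₀ (by norm_num) (by omega)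
  have h4 : 0 < (B * j) ^ j := by positivity
  nlinarith

lemma FF_mem : MemCSharp MM (FF 0) 0 (2 * Real.pi) := by
  set S := ∑' k : ℕ, Real.exp (-1/2) ^ k with hS
  set S1 := ∑' k, TT 1 k with hS1
  have hS1n : 0 ≤ S1 := tsum_nonneg (TT_nonneg 1)
  have hm : 1 ≤ max 1 S := le_max_left _ _
  refine ⟨max 1 S * 18 + 2 * S1, by positivity, ?_⟩
  intro j hj x _
  rw [FF_iter]
  by_cases h2 : 2 ≤ j
  · have hb := base_ge j h2
    rw [MM_two j h2]
    calc |FF j x| ≤ ∑' k, TT j k := FF_abs_le j x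
      _ ≤ ∑' k, (18 * (j * Real.log j)) ^ j * Real.exp (-1/2) ^ k :=
          (TT_summable j).tsum_le_tsum (fun k => TT_le j k h2) (geo.mul_left _)
      _ = (18 * (j * Real.log j)) ^ j * S := by rw [tsum_mul_left]
      _ ≤ (18 * (j * Real.log j)) ^ j * (max 1 S) ^ j := by
          gcongr
          exact (le_max_right 1 S).trans (le_self_pow₀ hm (by omega))
      _ = (max 1 S * 18) ^ j * (j * Real.log j) ^ j := by rw [mul_pow, mul_pow]; ring
      _ ≤ _ := by
          gcongr
          linarith
  · obtain rfl : j = 1 := by omega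
    have h1 : MM 1 = 1/2 := by norm_num [MM]
    rw [h1, pow_one]
    have := FF_abs_le 1 x
    linarith

end QA


/-- There exists a `2π`-periodic `C^∞` function `f : ℝ → ℝ` in the quasianalytic
class `C^#{(j log j)^j}` on `[0, 2π]` which coincides with any real analytic
function in at most a discrete set. -/
theorem exists_quasianalytic_meeting_analytic_discretely :
    ∃ M : ℕ → ℝ,
      (∀ j, 0 < M j) ∧ Monotone M ∧
      (∀ j : ℕ, M (j + 1) ^ 2 ≤ M j * M (j + 2)) ∧
      (∀ j : ℕ, 2 ≤ j → M j = ((j : ℝ) * Real.log j) ^ j) ∧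
      ∃ f : ℝ → ℝ,
        ContDiff ℝ (⊤ : ℕ∞) f ∧ Function.Periodic f (2 * Real.pi) ∧
        MemCSharp M f 0 (2 * Real.pi) ∧
        ∀ α β : ℝ, α < β → ∀ g : ℝ → ℝ, AnalyticOnNhd ℝ g (Set.Ioo α β) →
          ∀ t ∈ Set.Ioo α β, ¬ AccPt t (𝓟 {x ∈ Set.Ioo α β | f x = g x}) := by
  refine ⟨QA.MM, QA.MM_pos, QA.MM_mono, QA.MM_logconv, QA.MM_two, QA.FF 0, QA.FF_contDiff,
    QA.FF_periodic, QA.FF_mem, ?_⟩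
  intro α β _ g hg t ht hacc
  rw [accPt_iff_frequently_nhdsNE] at hacc
  have hf : ∃ᶠ x in 𝓝[≠] t, QA.FF 0 x = g x := hacc.mono (fun x hx => hx.2)
  obtain ⟨B, hB, hb⟩ := QA.analytic_bound g t (hg t ht)
  refine QA.no_bound t B hB (fun j hj => ?_)
  rw [QA.eq_derivs g _ isOpen_Ioo hg t ht hf j]
  exact hb j hj
end
end

section
/- Let Φ be a real-valued real analytic function on an open neighborhood of 0 in R^2 with Φ(0,0) = 0 and Φ not identically zero, and suppose ζ_s ∈ R^2 is a sequence of zeros of Φ with ζ_s ≠ 0 and ζ_s → 0. Then, after passing to a subsequence of {ζ_s}, there exist a real analytic curve γ: (-ε, ε) → R^2 with γ(0) = 0 and Φ(γ(t)) = 0 for all t ∈ (-ε, ε), and a sequence t_s > 0 with t_s → 0 and γ(t_s) = ζ_s for all s. -/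
open Set Filter Topology

noncomputable section


/-- Projection of the plane onto the first axis. -/
def projX : ℝ × ℝ →L[ℝ] ℝ × ℝ :=
  (ContinuousLinearMap.inl ℝ ℝ ℝ).comp (ContinuousLinearMap.fst ℝ ℝ ℝ)

lemma projX_apply (z : ℝ × ℝ) : projX z = (z.1, 0) := by
  simp [projX]

lemma norm_projX_le : ‖projX‖ ≤ 1 := by
  refine ContinuousLinearMap.opNorm_le_bound _ zero_le_one fun z => ?_
  rw [projX_apply, one_mul, Prod.norm_def, Prod.norm_def]
  simp

/-- One summand of the divided difference of a power series in the second variable. -/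
def divTerm (P : FormalMultilinearSeries ℝ (ℝ × ℝ) ℝ) (n : ℕ) (k : Fin (n + 1)) :
    ContinuousMultilinearMap ℝ (fun _ : Fin n => ℝ × ℝ) ℝ :=
  ((P (n + 1)).curryMid k ((0, 1) : ℝ × ℝ)).compContinuousLinearMap
    (fun i => if k.succAbove i < k then ContinuousLinearMap.id ℝ (ℝ × ℝ) else projX)

/-- Divided difference of a power series in the second variable. -/
def divSeries (P : FormalMultilinearSeries ℝ (ℝ × ℝ) ℝ) : FormalMultilinearSeries ℝ (ℝ × ℝ) ℝ :=
  fun n => ∑ k : Fin (n + 1), divTerm P n k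

lemma norm_divTerm_le (P : FormalMultilinearSeries ℝ (ℝ × ℝ) ℝ) (n : ℕ) (k : Fin (n + 1)) :
    ‖divTerm P n k‖ ≤ ‖P (n + 1)‖ := by
  unfold divTerm
  refine (ContinuousMultilinearMap.norm_compContinuousLinearMap_le _ _).trans ?_
  have h1 : ‖(P (n + 1)).curryMid k ((0, 1) : ℝ × ℝ)‖ ≤ ‖P (n + 1)‖ := by
    refine (ContinuousLinearMap.le_opNorm _ _).trans ?_
    rw [ContinuousMultilinearMap.norm_curryMid]
    simp [Prod.norm_def]
  have h2 : (∏ i : Fin n, ‖(if k.succAbove i < k then ContinuousLinearMap.id ℝ (ℝ × ℝ)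
      else projX)‖) ≤ 1 := by
    refine Finset.prod_le_one (fun _ _ => norm_nonneg _) fun i _ => ?_
    split_ifs
    · exact ContinuousLinearMap.norm_id_le
    · exact norm_projX_le
  calc _ ≤ ‖P (n + 1)‖ * 1 := mul_le_mul h1 h2 (Finset.prod_nonneg fun _ _ => norm_nonneg _)
        (norm_nonneg _)
    _ = _ := mul_one _

lemma norm_divSeries_le (P : FormalMultilinearSeries ℝ (ℝ × ℝ) ℝ) (n : ℕ) :
    ‖divSeries P n‖ ≤ (n + 1) * ‖P (n + 1)‖ := by
  unfold divSeries
  refine (norm_sum_le _ _).trans ?_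
  refine (Finset.sum_le_sum fun k _ => norm_divTerm_le P n k).trans ?_
  simp

lemma divTerm_apply (P : FormalMultilinearSeries ℝ (ℝ × ℝ) ℝ) (n : ℕ) (k : Fin (n + 1))
    (z : ℝ × ℝ) :
    z.2 * divTerm P n k (fun _ => z) =
      P (n + 1) (fun i => if (i : ℕ) < k + 1 then z else projX z) -
      P (n + 1) (fun i => if (i : ℕ) < k then z else projX z) := by
  set w : Fin (n + 1) → ℝ × ℝ := fun i => if (i : ℕ) < k then z else projX z with hw
  have e1 : (fun i : Fin (n + 1) => if (i : ℕ) < k + 1 then z else projX z) =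
      Function.update w k z := by
    funext i
    by_cases h : i = k
    · subst h; simp
    · have h' : (i : ℕ) ≠ k := fun h' => h (Fin.ext h')
      simp only [Function.update_of_ne h, hw]
      have : ((i : ℕ) < k + 1) ↔ ((i : ℕ) < k) := by omega
      simp [this]
  have e2 : w = Function.update w k (projX z) := by
    rw [eq_comm, Function.update_eq_self_iff]; simp [hw]
  have e3 : z - projX z = z.2 • ((0, 1) : ℝ × ℝ) := by
    rw [projX_apply]; ext <;> simp
  rw [e1]
  conv_rhs => rw [e2]
  rw [Function.update_idem, ← ContinuousMultilinearMap.map_update_sub, e3,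
    ContinuousMultilinearMap.map_update_smul, smul_eq_mul]
  congr 1
  unfold divTerm
  rw [ContinuousMultilinearMap.compContinuousLinearMap_apply,
    ContinuousMultilinearMap.curryMid_apply]
  congr 1
  funext i
  by_cases h : i = k
  · subst h; simp
  · obtain ⟨j, rfl⟩ := Fin.exists_succAbove_eq h
    rw [Function.update_of_ne h, Fin.insertNth_apply_succAbove]
    simp only [hw, Fin.lt_def]
    split_ifs <;> simp

lemma divSeries_apply (P : FormalMultilinearSeries ℝ (ℝ × ℝ) ℝ) (n : ℕ) (z : ℝ × ℝ) :
    z.2 * divSeries P n (fun _ => z) =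
      P (n + 1) (fun _ => z) - P (n + 1) (fun _ => projX z) := by
  unfold divSeries
  rw [ContinuousMultilinearMap.sum_apply, Finset.mul_sum]
  simp_rw [divTerm_apply]
  rw [Fin.sum_univ_eq_sum_range (fun k => P (n + 1) (fun i => if (i : ℕ) < k + 1 then z else projX z) -
      P (n + 1) (fun i => if (i : ℕ) < k then z else projX z)) (n + 1),
    Finset.sum_range_sub (fun k => P (n + 1) (fun i => if (i : ℕ) < k then z else projX z))]
  congr 2
  · funext i
    simp [i.2]

/-- Division by the second variable. -/
lemma exists_division {f : ℝ × ℝ → ℝ} (hf : AnalyticAt ℝ f 0) :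
    ∃ g : ℝ × ℝ → ℝ, AnalyticAt ℝ g 0 ∧ ∀ᶠ z in 𝓝 (0 : ℝ × ℝ), f z = f (z.1, 0) + z.2 * g z := by
  obtain ⟨P, r, hP⟩ := hf
  obtain ⟨C, K, hC, hK, hb⟩ := P.le_mul_pow_of_radius_pos (hP.r_pos.trans_le hP.r_le)
  have hrad : 0 < (divSeries P).radius := by
    obtain ⟨ρ, hρ⟩ : ∃ ρ : NNReal, (ρ : ℝ) = (2 * K)⁻¹ :=
      ⟨Real.toNNReal (2 * K)⁻¹, Real.coe_toNNReal _ (by positivity)⟩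
    have hρ0 : 0 < ρ := by
      rw [← NNReal.coe_pos, hρ]; positivity
    refine lt_of_lt_of_le (ENNReal.coe_pos.2 hρ0)
      (FormalMultilinearSeries.le_radius_of_bound _ (C * K) (r := ρ) fun n => ?_)
    have h1 : ((n : ℝ) + 1) ≤ 2 ^ n := by exact_mod_cast Nat.lt_two_pow_self
    calc ‖divSeries P n‖ * (ρ : ℝ) ^ n ≤ ((n + 1) * (C * K ^ (n + 1))) * (ρ : ℝ) ^ n := by
          gcongr
          refine (norm_divSeries_le P n).trans ?_
          gcongr
          exact hb _
      _ ≤ (2 ^ n * (C * K ^ (n + 1))) * (ρ : ℝ) ^ n := by gcongr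
      _ = C * K := by
          rw [hρ, inv_pow, mul_pow, pow_succ]
          field_simp
  have hQ := (divSeries P).hasFPowerSeriesOnBall hrad
  refine ⟨(divSeries P).sum, hQ.analyticAt, ?_⟩
  have hb1 : ∀ᶠ z in 𝓝 (0 : ℝ × ℝ), z ∈ Metric.eball (0 : ℝ × ℝ) r :=
    Metric.eball_mem_nhds _ hP.r_pos
  have hb3 : ∀ᶠ z in 𝓝 (0 : ℝ × ℝ), projX z ∈ Metric.eball (0 : ℝ × ℝ) r := by
    have : Tendsto projX (𝓝 0) (𝓝 0) := by
      simpa using projX.continuous.tendsto 0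
    exact this.eventually hb1
  have hb2 : ∀ᶠ z in 𝓝 (0 : ℝ × ℝ), z ∈ Metric.eball (0 : ℝ × ℝ) (divSeries P).radius :=
    Metric.eball_mem_nhds _ hrad
  filter_upwards [hb1, hb2, hb3] with z h1 h2 h3
  have s1 := (hP.hasSum h1).sub (hP.hasSum h3)
  have s2 := (hQ.hasSum h2).mul_left z.2
  simp only [zero_add] at s1 s2
  simp_rw [divSeries_apply] at s2
  have s3 := (hasSum_nat_add_iff' 1).2 s1
  have := s3.unique s2
  simp only [Finset.range_one, Finset.sum_singleton, projX_apply] at this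
  have h00 : (P 0) (fun _ => z) = (P 0) (fun _ => ((z.1, 0) : ℝ × ℝ)) := by
    congr 1; funext i; exact i.elim0
  linarith

/-- Partial derivative in the second variable. -/
def Ly (f : ℝ × ℝ → ℝ) : ℝ × ℝ → ℝ := fun z => fderiv ℝ f z (0, 1)

lemma Ly_analytic {f : ℝ × ℝ → ℝ} {z : ℝ × ℝ} (hf : AnalyticAt ℝ f z) : AnalyticAt ℝ (Ly f) z :=
  ((ContinuousLinearMap.apply ℝ ℝ ((0, 1) : ℝ × ℝ)).analyticAt _).comp hf.fderiv

lemma Ly_iter_analytic {f : ℝ × ℝ → ℝ} {z : ℝ × ℝ} (hf : AnalyticAt ℝ f z) (k : ℕ) :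
    AnalyticAt ℝ (Ly^[k] f) z := by
  induction k with
  | zero => exact hf
  | succ k ih => rw [Function.iterate_succ_apply']; exact Ly_analytic ih

lemma hasDerivAt_slice {f : ℝ × ℝ → ℝ} {x y : ℝ} (hf : AnalyticAt ℝ f (x, y)) :
    HasDerivAt (fun y => f (x, y)) (Ly f (x, y)) y := by
  have h1 : HasDerivAt (fun y : ℝ => (x, y)) ((0, 1) : ℝ × ℝ) y :=
    (hasDerivAt_const y x).prodMk (hasDerivAt_id y)
  exact hf.differentiableAt.hasFDerivAt.comp_hasDerivAt y h1

lemma iteratedDeriv_slice {f : ℝ × ℝ → ℝ} {x y : ℝ} (hf : AnalyticAt ℝ f (x, y)) (k : ℕ) :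
    iteratedDeriv k (fun y => f (x, y)) y = Ly^[k] f (x, y) := by
  induction k generalizing f with
  | zero => simp
  | succ k ih =>
    rw [iteratedDeriv_succ', Function.iterate_succ_apply, ← ih (Ly_analytic hf)]
    apply Filter.EventuallyEq.iteratedDeriv_eq
    have h : Tendsto (fun y' : ℝ => (x, y')) (𝓝 y) (𝓝 (x, y)) := by
      have : Continuous (fun y' : ℝ => (x, y')) := by fun_prop
      exact this.tendsto y
    filter_upwards [h.eventually hf.eventually_analyticAt] with y' hy'
    exact (hasDerivAt_slice hy').deriv

lemma Ly_congr {f g : ℝ × ℝ → ℝ} {z : ℝ × ℝ} (h : f =ᶠ[𝓝 z] g) (k : ℕ) :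
    Ly^[k] f =ᶠ[𝓝 z] Ly^[k] g := by
  induction k with
  | zero => exact h
  | succ k ih =>
    rw [Function.iterate_succ_apply', Function.iterate_succ_apply']
    filter_upwards [ih.fderiv (𝕜 := ℝ)] with w hw
    simp [Ly, hw]

lemma iteratedDeriv_remainder (m : ℕ) (a : ℕ → ℝ) {v φ : ℝ → ℝ} (hv : AnalyticAt ℝ v 0)
    (h : ∀ᶠ y in 𝓝 (0 : ℝ), φ y = ∑ j ∈ Finset.range m, a j * y ^ j + y ^ m * v y) :
    iteratedDeriv m φ 0 = m.factorial * v 0 := by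
  have h' : φ =ᶠ[𝓝 0] fun y => ∑ j ∈ Finset.range m, a j * y ^ j + y ^ m * v y := h
  rw [h'.iteratedDeriv_eq]
  have hs : ∀ j ∈ Finset.range m, ContDiffAt ℝ m (fun y : ℝ => a j * y ^ j) 0 := by
    intro j _; fun_prop
  have hv' : ContDiffAt ℝ m v 0 := hv.contDiffAt
  rw [iteratedDeriv_fun_add (ContDiffAt.sum hs) (by fun_prop), iteratedDeriv_fun_sum hs,
    iteratedDeriv_fun_mul (by fun_prop) hv']
  rw [Finset.sum_eq_zero, Finset.sum_eq_single m]
  · rw [iteratedDeriv_fun_pow_zero]; simp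
  · intro i _ hi
    rw [iteratedDeriv_fun_pow_zero]; simp [hi]
  · simp
  · intro j hj
    have : m ≠ j := (Finset.mem_range.1 hj).ne'
    rw [iteratedDeriv_const_mul_field]
    rw [iteratedDeriv_fun_pow_zero]; simp [this]

lemma eventually_slice {p : ℝ × ℝ → Prop} (h : ∀ᶠ z in 𝓝 (0 : ℝ × ℝ), p z) :
    ∀ᶠ x in 𝓝 (0 : ℝ), ∀ᶠ y in 𝓝 (0 : ℝ), p (x, y) := by
  have : (0 : ℝ × ℝ) = (0, 0) := rfl
  rw [this, nhds_prod_eq] at h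
  exact h.curry

lemma eventually_axis {p : ℝ × ℝ → Prop} (h : ∀ᶠ z in 𝓝 (0 : ℝ × ℝ), p z) :
    ∀ᶠ x in 𝓝 (0 : ℝ), p (x, 0) :=
  (eventually_slice h).mono fun _ hx => hx.self_of_nhds

lemma eventually_of_fst {p : ℝ → Prop} (h : ∀ᶠ x in 𝓝 (0 : ℝ), p x) :
    ∀ᶠ z in 𝓝 (0 : ℝ × ℝ), p z.1 :=
  (continuous_fst.tendsto (0 : ℝ × ℝ)).eventually h

/-- Taylor formula with analytic remainder in the second variable. -/
lemma taylor_y {f : ℝ × ℝ → ℝ} (hf : AnalyticAt ℝ f 0) (m : ℕ) :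
    ∃ u : ℝ × ℝ → ℝ, AnalyticAt ℝ u 0 ∧
      (∀ᶠ z in 𝓝 (0 : ℝ × ℝ), f z =
        ∑ j ∈ Finset.range m, (Ly^[j] f (z.1, 0) / j.factorial) * z.2 ^ j + z.2 ^ m * u z) ∧
      (∀ᶠ x in 𝓝 (0 : ℝ), u (x, 0) = Ly^[m] f (x, 0) / m.factorial) := by
  have key : ∀ (m : ℕ) (u : ℝ × ℝ → ℝ), AnalyticAt ℝ u 0 →
      (∀ᶠ z in 𝓝 (0 : ℝ × ℝ), f z =
        ∑ j ∈ Finset.range m, (Ly^[j] f (z.1, 0) / j.factorial) * z.2 ^ j + z.2 ^ m * u z) →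
      (∀ᶠ x in 𝓝 (0 : ℝ), u (x, 0) = Ly^[m] f (x, 0) / m.factorial) := by
    intro m u hu h
    filter_upwards [eventually_slice h, eventually_axis hf.eventually_analyticAt,
      eventually_axis hu.eventually_analyticAt] with x hx hfx hux
    have hv : AnalyticAt ℝ (fun y => u (x, y)) 0 :=
      AnalyticAt.fun_comp (g := u) (f := fun y : ℝ => (x, y)) hux (by fun_prop)
    have := iteratedDeriv_remainder m (fun j => Ly^[j] f (x, 0) / j.factorial)
      (φ := fun y => f (x, y)) hv hx
    rw [iteratedDeriv_slice hfx] at this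
    rw [this]
    have : (m.factorial : ℝ) ≠ 0 := by exact_mod_cast m.factorial_ne_zero
    field_simp
  suffices H : ∃ u : ℝ × ℝ → ℝ, AnalyticAt ℝ u 0 ∧
      (∀ᶠ z in 𝓝 (0 : ℝ × ℝ), f z =
        ∑ j ∈ Finset.range m, (Ly^[j] f (z.1, 0) / j.factorial) * z.2 ^ j + z.2 ^ m * u z) by
    obtain ⟨u, hu, h⟩ := H
    exact ⟨u, hu, h, key m u hu h⟩
  induction m with
  | zero => exact ⟨f, hf, by simp⟩
  | succ m ih =>
    obtain ⟨u, hu, h⟩ := ih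
    have hk := key m u hu h
    obtain ⟨g, hg, hug⟩ := exists_division hu
    refine ⟨g, hg, ?_⟩
    filter_upwards [h, hug, eventually_of_fst hk] with z h1 h2 h3
    rw [h1, Finset.sum_range_succ, h2, h3]
    ring

/-- Analytic implicit function theorem. -/
lemma implicit_y {D : ℝ × ℝ → ℝ} (hD : AnalyticAt ℝ D 0) (h0 : D 0 = 0) (h1 : Ly D 0 ≠ 0) :
    ∃ α : ℝ → ℝ, AnalyticAt ℝ α 0 ∧ α 0 = 0 ∧ ∀ᶠ x in 𝓝 (0 : ℝ), D (x, α x) = 0 := by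
  have hc : ContDiffAt ℝ ⊤ D 0 := hD.contDiffAt
  have hinv : (fderiv ℝ D 0 ∘L .inr ℝ ℝ ℝ).IsInvertible := by
    refine ⟨ContinuousLinearEquiv.unitsEquivAut ℝ (Units.mk0 _ h1), ?_⟩
    ext
    simp [Ly]
  refine ⟨hc.implicitFunction (by simp) hinv, ?_, ?_, ?_⟩
  · exact (hc.contDiffAt_implicitFunction (by simp) hinv).analyticAt
  · exact hc.implicitFunction_apply_self (by simp) hinv
  · have := hc.eventually_apply_implicitFunction (by simp) hinv
    rw [h0] at this
    exact this


attribute [local fun_prop] analyticAt_fst analyticAt_snd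

lemma root_bound (m : ℕ) (hm : 0 < m) (a : ℕ → ℝ) (C δ v w : ℝ) (hδ : 0 < δ) (hv : δ ≤ |v|)
    (ha : ∀ j < m, |a j| ≤ C) (h : ∑ j ∈ Finset.range m, a j * w ^ j + w ^ m * v = 0) :
    |w| ≤ max 1 (m * C / δ) := by
  by_cases hw : |w| ≤ 1
  · exact hw.trans (le_max_left _ _)
  push Not at hw
  refine le_trans ?_ (le_max_right _ _)
  obtain ⟨n, rfl⟩ : ∃ n, m = n + 1 := ⟨m - 1, by omega⟩
  have hC : 0 ≤ C := (abs_nonneg _).trans (ha 0 hm)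
  have h1 : |w| ^ (n + 1) * |v| = |∑ j ∈ Finset.range (n + 1), a j * w ^ j| := by
    rw [← abs_pow, ← abs_mul, eq_neg_of_add_eq_zero_right h, abs_neg]
  have h2 : |∑ j ∈ Finset.range (n + 1), a j * w ^ j| ≤ ((n + 1 : ℕ) : ℝ) * (C * |w| ^ n) := by
    refine (Finset.abs_sum_le_sum_abs _ _).trans ?_
    refine (Finset.sum_le_card_nsmul _ _ (C * |w| ^ n) fun j hj => ?_).trans ?_
    · have hj' := Finset.mem_range.1 hj
      rw [abs_mul, abs_pow]
      exact mul_le_mul (ha j hj') (pow_le_pow_right₀ hw.le (by omega)) (by positivity) hC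
    · simp
  rw [le_div_iff₀ hδ]
  have hpos : 0 < |w| ^ n := by positivity
  refine le_of_mul_le_mul_left ?_ hpos
  calc |w| ^ n * (|w| * δ) = |w| ^ (n + 1) * δ := by ring
    _ ≤ |w| ^ (n + 1) * |v| := by gcongr
    _ ≤ ((n + 1 : ℕ) : ℝ) * (C * |w| ^ n) := by rw [h1]; exact h2
    _ = _ := by ring

lemma iteratedDeriv_poly (P : Polynomial ℝ) (k : ℕ) :
    iteratedDeriv k (fun w => P.eval w) = fun w => (Polynomial.derivative^[k] P).eval w := by
  induction k with
  | zero => simp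
  | succ k ih =>
    rw [iteratedDeriv_succ, ih, Function.iterate_succ_apply']
    funext w
    exact Polynomial.deriv _

lemma exists_deriv_ne (m : ℕ) (hm : 0 < m) (e : ℕ → ℝ) (v : ℝ) (hv : v ≠ 0) (he : e (m - 1) = 0)
    (hne : ∃ j < m, e j ≠ 0) (w0 : ℝ) :
    ∃ k < m, iteratedDeriv k (fun w => ∑ j ∈ Finset.range m, e j * w ^ j + w ^ m * v) w0 ≠ 0 := by
  by_contra! hcon
  obtain ⟨n, rfl⟩ : ∃ n, m = n + 1 := ⟨m - 1, by omega⟩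
  set P : Polynomial ℝ := ∑ j ∈ Finset.range (n + 1), Polynomial.C (e j) * Polynomial.X ^ j +
    Polynomial.C v * Polynomial.X ^ (n + 1) with hP
  have hPe : (fun w => ∑ j ∈ Finset.range (n + 1), e j * w ^ j + w ^ (n + 1) * v) =
      fun w => P.eval w := by
    funext w
    simp [hP, Polynomial.eval_finsetSum, mul_comm v]
  rw [hPe] at hcon
  simp only [iteratedDeriv_poly] at hcon
  have hcoef : ∀ j < n + 1, P.coeff j = e j := by
    intro j hj
    simp only [hP, Polynomial.coeff_add, Polynomial.finsetSum_coeff, Polynomial.coeff_C_mul,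
      Polynomial.coeff_X_pow]
    rw [Finset.sum_eq_single j]
    · simp [hj.ne]
    · intro b _ hb; simp [hb.symm]
    · intro h; exact absurd (Finset.mem_range.2 hj) h
  have hlead : P.coeff (n + 1) = v := by
    simp only [hP, Polynomial.coeff_add, Polynomial.finsetSum_coeff, Polynomial.coeff_C_mul,
      Polynomial.coeff_X_pow]
    rw [Finset.sum_eq_zero]
    · simp
    · intro b hb
      have := (Finset.mem_range.1 hb).ne'
      simp [this]
  have hdeg : P.natDegree ≤ n + 1 := by
    rw [hP]
    refine Polynomial.natDegree_add_le_of_degree_le ?_ (Polynomial.natDegree_C_mul_X_pow_le _ _)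
    refine Polynomial.natDegree_sum_le_of_forall_le _ _ fun j hj => ?_
    exact (Polynomial.natDegree_C_mul_X_pow_le _ _).trans (Finset.mem_range.1 hj).le
  have hw0 : w0 = 0 := by
    have h := hcon n (by omega)
    have hd : (Polynomial.derivative^[n] P).natDegree < 2 := by
      have := Polynomial.natDegree_iterate_derivative P n
      omega
    rw [Polynomial.eval_eq_sum_range' hd] at h
    simp only [Finset.sum_range_succ, Finset.sum_range_zero, Polynomial.coeff_iterate_derivative,
      zero_add] at h
    rw [hcoef n (by omega), show 1 + n = n + 1 by ring, hlead] at h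
    simp only [Nat.add_sub_cancel] at he
    rw [he] at h
    have h' : ((n + 1).descFactorial n : ℝ) ≠ 0 := by
      have : (n + 1).descFactorial n ≠ 0 := by
        rw [Ne, Nat.descFactorial_eq_zero_iff_lt]; omega
      exact_mod_cast this
    simpa [hv, h'] using h
  obtain ⟨j, hj, hej⟩ := hne
  have h := hcon j hj
  rw [hw0, ← Polynomial.coeff_zero_eq_eval_zero, Polynomial.coeff_iterate_derivative, zero_add,
    hcoef j hj] at h
  have h' : (j).descFactorial j ≠ 0 := by
    rw [Ne, Nat.descFactorial_eq_zero_iff_lt]; omega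
  exact (smul_ne_zero h' hej) h

lemma newton (m : ℕ) (c : ℕ → ℝ → ℝ) (hc : ∀ j < m, AnalyticAt ℝ (c j) 0)
    (h0 : ∀ j < m, c j 0 = 0) (hne : ∃ j < m, ¬ ∀ᶠ x in 𝓝 (0 : ℝ), c j x = 0) :
    ∃ p q : ℕ, 0 < p ∧ 0 < q ∧ ∃ e : ℕ → ℝ → ℝ, (∀ j < m, AnalyticAt ℝ (e j) 0) ∧
      (∀ j < m, ∀ᶠ t in 𝓝 (0 : ℝ), c j (t ^ q) = t ^ (p * (m - j)) * e j t) ∧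
      (∃ j < m, e j 0 ≠ 0) ∧ (∀ j < m, (∀ᶠ x in 𝓝 (0 : ℝ), c j x = 0) → e j 0 = 0) := by
  classical
  have hfac : ∀ j < m, (¬ ∀ᶠ x in 𝓝 (0 : ℝ), c j x = 0) → ∃ (ν : ℕ) (d : ℝ → ℝ), 0 < ν ∧
      AnalyticAt ℝ d 0 ∧ d 0 ≠ 0 ∧ ∀ᶠ x in 𝓝 (0 : ℝ), c j x = x ^ ν * d x := by
    intro j hj hnz
    obtain ⟨ν, d, hd, hd0, hcd⟩ := (hc j hj).exists_eventuallyEq_pow_smul_nonzero_iff.2 hnz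
    simp only [sub_zero, smul_eq_mul] at hcd
    refine ⟨ν, d, ?_, hd, hd0, hcd⟩
    rcases Nat.eq_zero_or_pos ν with rfl | h
    · have := hcd.self_of_nhds
      rw [h0 j hj] at this
      simp at this
      exact absurd this.symm hd0
    · exact h
  choose! ν d hν hd hd0 hcd using hfac
  set S := (Finset.range m).filter (fun j => ¬ ∀ᶠ x in 𝓝 (0 : ℝ), c j x = 0) with hS
  have hSmem : ∀ j, j ∈ S ↔ j < m ∧ ¬ ∀ᶠ x in 𝓝 (0 : ℝ), c j x = 0 := by
    intro j; simp [hS]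
  have hSne : S.Nonempty := by
    obtain ⟨j, hj, h⟩ := hne
    exact ⟨j, (hSmem j).2 ⟨hj, h⟩⟩
  obtain ⟨j0, hj0, hmin⟩ := S.exists_min_image (fun j => ν j * (m.factorial / (m - j))) hSne
  set p := ν j0 * (m.factorial / (m - j0)) with hp
  have hdiv : ∀ j < m, m.factorial / (m - j) * (m - j) = m.factorial := fun j hj =>
    Nat.div_mul_cancel (Nat.dvd_factorial (by omega) (by omega))
  have hj0' := (hSmem j0).1 hj0
  have hq : 0 < m.factorial := m.factorial_pos
  have hle : ∀ j ∈ S, p * (m - j) ≤ m.factorial * ν j := by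
    intro j hj
    calc p * (m - j) ≤ (ν j * (m.factorial / (m - j))) * (m - j) :=
          Nat.mul_le_mul_right _ (hmin j hj)
      _ = m.factorial * ν j := by rw [mul_assoc, hdiv j ((hSmem j).1 hj).1, mul_comm]
  have heq : p * (m - j0) = m.factorial * ν j0 := by
    rw [hp, mul_assoc, hdiv j0 hj0'.1, mul_comm]
  have htend : Tendsto (fun t : ℝ => t ^ m.factorial) (𝓝 0) (𝓝 0) := by
    have : Continuous (fun t : ℝ => t ^ m.factorial) := by fun_prop
    simpa [hq.ne'] using this.tendsto 0
  refine ⟨p, m.factorial, ?_, hq, fun j t => if j ∈ S then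
    t ^ (m.factorial * ν j - p * (m - j)) * d j (t ^ m.factorial) else 0, ?_, ?_, ?_, ?_⟩
  · refine Nat.mul_pos (hν j0 hj0'.1 hj0'.2) (Nat.pos_of_ne_zero fun h => ?_)
    have := hdiv j0 hj0'.1
    rw [h] at this
    omega
  · intro j hj
    by_cases h : j ∈ S
    · simp only [h, if_true]
      have h2 := (hSmem j).1 h
      have : AnalyticAt ℝ (fun t : ℝ => d j (t ^ m.factorial)) 0 := by
        refine AnalyticAt.fun_comp (g := d j) (f := fun t : ℝ => t ^ m.factorial) ?_ (by fun_prop)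
        simpa [hq.ne'] using hd j h2.1 h2.2
      exact AnalyticAt.fun_mul (by fun_prop) this
    · simp only [h, if_false]
      exact analyticAt_const
  · intro j hj
    by_cases h : j ∈ S
    · simp only [h, if_true]
      have h2 := (hSmem j).1 h
      filter_upwards [htend.eventually (hcd j h2.1 h2.2)] with t ht
      rw [ht, ← mul_assoc, ← pow_add, Nat.add_sub_cancel' (hle j h), pow_mul]
    · simp only [h, if_false, mul_zero]
      have : ∀ᶠ x in 𝓝 (0 : ℝ), c j x = 0 := by
        by_contra h3; exact h ((hSmem j).2 ⟨hj, h3⟩)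
      exact htend.eventually this
  · refine ⟨j0, hj0'.1, ?_⟩
    simp only [hj0, if_true, heq, Nat.sub_self, pow_zero, one_mul]
    simpa [hq.ne'] using hd0 j0 hj0'.1 hj0'.2
  · intro j hj hz
    have : j ∉ S := fun h => ((hSmem j).1 h).2 hz
    simp [this]

/-- The conclusion at the level of ultrafilters. -/
def Good (m : ℕ) : Prop := ∀ Φ : ℝ × ℝ → ℝ, AnalyticAt ℝ Φ 0 → Ly^[m] Φ 0 ≠ 0 →
  ∀ F : Ultrafilter (ℝ × ℝ), (F : Filter (ℝ × ℝ)) ≤ 𝓝 0 →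
    (∀ᶠ z in (F : Filter (ℝ × ℝ)), 0 < z.1) → (∀ᶠ z in (F : Filter (ℝ × ℝ)), Φ z = 0) →
    ∃ γ : ℝ → ℝ × ℝ, AnalyticAt ℝ γ 0 ∧ γ 0 = 0 ∧ (∀ᶠ τ in 𝓝 (0 : ℝ), Φ (γ τ) = 0) ∧
      (F : Filter (ℝ × ℝ)) ≤ map γ (𝓝[>] 0)

lemma analytic_axis {f : ℝ × ℝ → ℝ} (hf : AnalyticAt ℝ f 0) :
    AnalyticAt ℝ (fun x => f (x, 0)) 0 :=
  AnalyticAt.fun_comp (g := f) (f := fun x : ℝ => (x, (0 : ℝ))) hf (by fun_prop)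

/-- Transport of a curve through a map. -/
lemma transport {Φ Ψ : ℝ × ℝ → ℝ} {ρ θ : ℝ × ℝ → ℝ × ℝ} (F : Ultrafilter (ℝ × ℝ))
    (hρ : AnalyticAt ℝ ρ 0) (hρ0 : ρ 0 = 0)
    (hΨ : ∀ᶠ z in 𝓝 (0 : ℝ × ℝ), Ψ z = 0 → Φ (ρ z) = 0)
    (hid : ∀ᶠ z in (F : Filter (ℝ × ℝ)), ρ (θ z) = z)
    (h : ∃ γ : ℝ → ℝ × ℝ, AnalyticAt ℝ γ 0 ∧ γ 0 = 0 ∧ (∀ᶠ τ in 𝓝 (0 : ℝ), Ψ (γ τ) = 0) ∧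
      ((F.map θ : Ultrafilter (ℝ × ℝ)) : Filter (ℝ × ℝ)) ≤ map γ (𝓝[>] 0)) :
    ∃ γ : ℝ → ℝ × ℝ, AnalyticAt ℝ γ 0 ∧ γ 0 = 0 ∧ (∀ᶠ τ in 𝓝 (0 : ℝ), Φ (γ τ) = 0) ∧
      (F : Filter (ℝ × ℝ)) ≤ map γ (𝓝[>] 0) := by
  obtain ⟨γ, h1, h2, h3, h4⟩ := h
  refine ⟨ρ ∘ γ, ?_, ?_, ?_, ?_⟩
  · refine AnalyticAt.comp ?_ h1
    rwa [h2]
  · simp [h2, hρ0]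
  · have : Tendsto γ (𝓝 0) (𝓝 0) := by
      have := h1.continuousAt.tendsto
      rwa [h2] at this
    filter_upwards [h3, this.eventually hΨ] with τ ha hb
    exact hb ha
  · have h5 := map_mono (m := ρ) h4
    rw [Ultrafilter.coe_map, map_map, map_map] at h5
    refine le_trans ?_ h5
    intro s hs
    have hs' : ∀ᶠ z in (F : Filter (ℝ × ℝ)), ρ (θ z) ∈ s := hs
    filter_upwards [hs', hid] with z a b
    rwa [b] at a

lemma step (m : ℕ) (hm : 0 < m) (IH : ∀ k < m, Good k) (Φ : ℝ × ℝ → ℝ) (hΦ : AnalyticAt ℝ Φ 0)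
    (h1 : ∀ᶠ x in 𝓝 (0 : ℝ), Ly^[m - 1] Φ (x, 0) = 0) (h2 : ∀ k < m, Ly^[k] Φ 0 = 0)
    (h3 : Ly^[m] Φ 0 ≠ 0) (F : Ultrafilter (ℝ × ℝ)) (hF : (F : Filter (ℝ × ℝ)) ≤ 𝓝 0)
    (hFx : ∀ᶠ z in (F : Filter (ℝ × ℝ)), 0 < z.1)
    (hFz : ∀ᶠ z in (F : Filter (ℝ × ℝ)), Φ z = 0) :
    ∃ γ : ℝ → ℝ × ℝ, AnalyticAt ℝ γ 0 ∧ γ 0 = 0 ∧ (∀ᶠ τ in 𝓝 (0 : ℝ), Φ (γ τ) = 0) ∧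
      (F : Filter (ℝ × ℝ)) ≤ map γ (𝓝[>] 0) := by
  obtain ⟨u, hu, hT, hux⟩ := taylor_y hΦ m
  have hu0 : u 0 ≠ 0 := by
    have := hux.self_of_nhds
    have h' : (m.factorial : ℝ) ≠ 0 := by exact_mod_cast m.factorial_ne_zero
    rw [show ((0, 0) : ℝ × ℝ) = 0 from rfl] at this
    rw [this]
    exact div_ne_zero h3 h'
  set c : ℕ → ℝ → ℝ := fun j x => Ly^[j] Φ (x, 0) / j.factorial with hc
  have hT' : ∀ᶠ z in 𝓝 (0 : ℝ × ℝ), Φ z =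
      ∑ j ∈ Finset.range m, c j z.1 * z.2 ^ j + z.2 ^ m * u z := hT
  have hca : ∀ j < m, AnalyticAt ℝ (c j) 0 := fun j _ => by
    have := analytic_axis (Ly_iter_analytic hΦ j)
    simp only [hc]
    exact this.div_const
  have hc0 : ∀ j < m, c j 0 = 0 := fun j hj => by
    simp only [hc]
    rw [show ((0, 0) : ℝ × ℝ) = 0 from rfl, h2 j hj, zero_div]
  have hunear : ∀ᶠ z in 𝓝 (0 : ℝ × ℝ), |u 0| / 2 ≤ |u z| := by
    have := (hu.continuousAt.abs).tendsto.eventually (lt_mem_nhds (half_lt_self (abs_pos.2 hu0)))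
    exact this.mono fun _ h => h.le
  have hx0 : Tendsto Prod.fst (F : Filter (ℝ × ℝ)) (𝓝[>] (0 : ℝ)) := by
    refine tendsto_nhdsWithin_iff.2 ⟨?_, hFx⟩
    exact ((continuous_fst.tendsto (0 : ℝ × ℝ))).mono_left hF
  by_cases hz : ∀ j < m, ∀ᶠ x in 𝓝 (0 : ℝ), c j x = 0
  · have hz' : ∀ᶠ x in 𝓝 (0 : ℝ), ∀ j ∈ Finset.range m, c j x = 0 :=
      (Finset.eventually_all _).2 fun j hj => hz j (Finset.mem_range.1 hj)
    have hform : ∀ᶠ z in 𝓝 (0 : ℝ × ℝ), Φ z = z.2 ^ m * u z := by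
      filter_upwards [hT', eventually_of_fst hz'] with z ha hb
      rw [ha, Finset.sum_eq_zero, zero_add]
      intro j hj
      rw [hb j hj, zero_mul]
    refine ⟨fun τ => (τ, 0), by fun_prop, rfl, ?_, ?_⟩
    · filter_upwards [eventually_axis hform] with τ hτ
      rw [hτ]
      simp [hm.ne']
    · intro s hs
      have hs' : ∀ᶠ τ in 𝓝[>] (0 : ℝ), (τ, (0 : ℝ)) ∈ s := hs
      filter_upwards [hx0.eventually hs', hFz, hF hform, hF hunear] with z a b e f
      have hne : u z ≠ 0 := by
        intro h
        rw [h, abs_zero] at f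
        have := abs_pos.2 hu0
        linarith
      have : z.2 = 0 := by
        have e' : Φ z = z.2 ^ m * u z := e
        rw [b] at e'
        have := (mul_eq_zero.1 e'.symm).resolve_right hne
        exact pow_eq_zero_iff hm.ne' |>.1 this
      rwa [← this] at a
  push Not at hz
  obtain ⟨p, q, hp, hq, e, hea, hec, hene, hez⟩ := newton m c hca hc0 (by
    obtain ⟨j, hj, h⟩ := hz
    exact ⟨j, hj, by simpa using h⟩)
  have hem : e (m - 1) 0 = 0 := by
    refine hez (m - 1) (by omega) ?_
    filter_upwards [h1] with x hx
    simp only [hc, hx, zero_div]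
  set Ψ : ℝ × ℝ → ℝ := fun z => ∑ j ∈ Finset.range m, e j z.1 * z.2 ^ j +
    z.2 ^ m * u (z.1 ^ q, z.1 ^ p * z.2) with hΨ
  have hec' : ∀ᶠ t in 𝓝 (0 : ℝ), ∀ j ∈ Finset.range m,
      c j (t ^ q) = t ^ (p * (m - j)) * e j t :=
    (Finset.eventually_all _).2 fun j hj => hec j (Finset.mem_range.1 hj)
  have hid : ∀ t w : ℝ, (∀ j ∈ Finset.range m, c j (t ^ q) = t ^ (p * (m - j)) * e j t) →
      (Φ (t ^ q, t ^ p * w) = ∑ j ∈ Finset.range m, c j (t ^ q) * (t ^ p * w) ^ j +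
        (t ^ p * w) ^ m * u (t ^ q, t ^ p * w)) →
      Φ (t ^ q, t ^ p * w) = t ^ (p * m) * Ψ (t, w) := by
    intro t w ha hb
    rw [hb]
    simp only [hΨ]
    rw [mul_add, Finset.mul_sum]
    congr 1
    · refine Finset.sum_congr rfl fun j hj => ?_
      have hj' := Finset.mem_range.1 hj
      rw [ha j hj, mul_pow, ← pow_mul]
      have : p * m = p * (m - j) + p * j := by
        rw [← mul_add, Nat.sub_add_cancel hj'.le]
      rw [this, pow_add]
      ring
    · rw [mul_pow, ← pow_mul]; ring
  have hΨa : ∀ w0 : ℝ, AnalyticAt ℝ Ψ (0, w0) := by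
    intro w0
    have e1 : ∀ j ∈ Finset.range m, AnalyticAt ℝ (fun z : ℝ × ℝ => e j z.1 * z.2 ^ j) (0, w0) := by
      intro j hj
      have : AnalyticAt ℝ (fun z : ℝ × ℝ => e j z.1) (0, w0) :=
        AnalyticAt.fun_comp (g := e j) (f := fun z : ℝ × ℝ => z.1)
          (hea j (Finset.mem_range.1 hj)) (by fun_prop)
      exact AnalyticAt.fun_mul this (by fun_prop)
    have e2 : AnalyticAt ℝ (fun z : ℝ × ℝ => u (z.1 ^ q, z.1 ^ p * z.2)) (0, w0) := by
      refine AnalyticAt.fun_comp (g := u) (f := fun z : ℝ × ℝ => (z.1 ^ q, z.1 ^ p * z.2)) ?_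
        (by fun_prop)
      simp only [zero_pow hp.ne', zero_pow hq.ne', zero_mul]
      exact hu
    exact AnalyticAt.fun_add (Finset.analyticAt_fun_sum _ e1) (AnalyticAt.fun_mul (by fun_prop) e2)
  -- the rescaled coordinates
  set τ : ℝ × ℝ → ℝ := fun z => z.1 ^ ((1 : ℝ) / q) with hτ
  have hτpos : ∀ᶠ z in (F : Filter (ℝ × ℝ)), 0 < τ z := hFx.mono fun z hz => Real.rpow_pos_of_pos hz _
  have hτq : ∀ᶠ z in (F : Filter (ℝ × ℝ)), τ z ^ q = z.1 := hFx.mono fun z hz => by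
    simp only [hτ, one_div]
    exact Real.rpow_inv_natCast_pow hz.le hq.ne'
  have hτ0 : Tendsto τ (F : Filter (ℝ × ℝ)) (𝓝 0) := by
    have h : Tendsto (fun x : ℝ => x ^ ((1 : ℝ) / q)) (𝓝 0) (𝓝 0) := by
      have hpos : (0 : ℝ) < 1 / q := by positivity
      have := (Real.continuousAt_rpow_const 0 ((1 : ℝ) / q) (Or.inr hpos.le)).tendsto
      rwa [Real.zero_rpow hpos.ne'] at this
    exact h.comp (hx0.mono_right nhdsWithin_le_nhds)
  set ω : ℝ × ℝ → ℝ := fun z => z.2 / τ z ^ p with hω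
  have hback : ∀ᶠ z in (F : Filter (ℝ × ℝ)), (τ z ^ q, τ z ^ p * ω z) = z := by
    filter_upwards [hτpos, hτq] with z ha hb
    ext
    · exact hb
    · simp only [hω]
      field_simp
  have hΨ0 : ∀ᶠ z in (F : Filter (ℝ × ℝ)), Ψ (τ z, ω z) = 0 := by
    filter_upwards [hτpos, hback, hFz, hF hT', hτ0.eventually hec'] with z ha hb hc' hd he
    have hd' : Φ z = ∑ j ∈ Finset.range m, c j z.1 * z.2 ^ j + z.2 ^ m * u z := hd
    have := hid (τ z) (ω z) he (by rw [← hb] at hd'; exact hd')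
    rw [hb, hc'] at this
    exact (mul_eq_zero.1 this.symm).resolve_left (pow_pos ha _).ne'
  have hebd : ∃ C : ℝ, ∀ᶠ t in 𝓝 (0 : ℝ), ∀ j ∈ Finset.range m, |e j t| ≤ C := by
    refine ⟨∑ j ∈ Finset.range m, (|e j 0| + 1), ?_⟩
    refine (Finset.eventually_all _).2 fun j hj => ?_
    have := ((hea j (Finset.mem_range.1 hj)).continuousAt.abs).tendsto.eventually
      (gt_mem_nhds (lt_add_one |e j 0|))
    filter_upwards [this] with t ht
    exact ht.le.trans (Finset.single_le_sum (f := fun j => |e j 0| + 1)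
      (fun i _ => by positivity) hj)
  obtain ⟨C, hC⟩ := hebd
  have hbd : ∀ᶠ z in (F : Filter (ℝ × ℝ)), ω z ∈ Metric.closedBall (0 : ℝ)
      (max 1 (m * C / (|u 0| / 2))) := by
    filter_upwards [hΨ0, hτ0.eventually hC, hback, hF hunear] with z ha hb hc' hd
    have hd' : |u 0| / 2 ≤ |u z| := hd
    rw [mem_closedBall_zero_iff, Real.norm_eq_abs]
    refine root_bound m hm (fun j => e j (τ z)) C (|u 0| / 2) (u z) (ω z)
      (half_pos (abs_pos.2 hu0)) hd' (fun j hj => hb j (Finset.mem_range.2 hj)) ?_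
    simp only [hΨ, hc'] at ha
    exact ha
  obtain ⟨w0, -, hw0⟩ := isCompact_iff_ultrafilter_le_nhds.1
    (isCompact_closedBall (0 : ℝ) (max 1 (m * C / (|u 0| / 2)))) (F.map ω)
    (by rw [le_principal_iff]; exact hbd)
  have hωt : Tendsto ω (F : Filter (ℝ × ℝ)) (𝓝 w0) := hw0
  -- induction hypothesis
  obtain ⟨k, hk, hkne⟩ := exists_deriv_ne m hm (fun j => e j 0) (u 0) hu0 hem hene w0
  have hΨ'a : AnalyticAt ℝ (fun z : ℝ × ℝ => Ψ (z.1, z.2 + w0)) 0 := by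
    refine AnalyticAt.fun_comp (g := Ψ) (f := fun z : ℝ × ℝ => (z.1, z.2 + w0)) ?_ (by fun_prop)
    simpa using hΨa w0
  have hLy : Ly^[k] (fun z : ℝ × ℝ => Ψ (z.1, z.2 + w0)) 0 ≠ 0 := by
    have := iteratedDeriv_slice (x := 0) (y := 0) hΨ'a k
    rw [show (0 : ℝ × ℝ) = (0, 0) from rfl, ← this]
    have h4 := congrFun (iteratedDeriv_comp_add_const k (fun y => Ψ (0, y)) w0) 0
    simp only at h4 ⊢
    rw [h4, zero_add]
    convert hkne using 3 with w
    simp only [hΨ, zero_pow hp.ne', zero_pow hq.ne', zero_mul]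
    rfl
  refine transport (Ψ := fun z : ℝ × ℝ => Ψ (z.1, z.2 + w0))
    (ρ := fun z => (z.1 ^ q, z.1 ^ p * (z.2 + w0))) (θ := fun z => (τ z, ω z - w0)) F
    (by fun_prop) (by simp [hp.ne', hq.ne']) ?_ ?_ (IH k hk _ hΨ'a hLy _ ?_ ?_ ?_)
  · have ht : Tendsto (fun z : ℝ × ℝ => (z.1 ^ q, z.1 ^ p * (z.2 + w0))) (𝓝 0) (𝓝 0) := by
      have hcont : Continuous (fun z : ℝ × ℝ => (z.1 ^ q, z.1 ^ p * (z.2 + w0))) := by fun_prop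
      have := hcont.tendsto 0
      simp only [Prod.fst_zero, Prod.snd_zero, zero_pow hp.ne', zero_pow hq.ne', zero_mul] at this
      exact this
    filter_upwards [ht.eventually hT', eventually_of_fst hec'] with z ha hb hc'
    rw [hid z.1 (z.2 + w0) hb ha, hc', mul_zero]
  · filter_upwards [hback] with z hz'
    simpa using hz'
  · have : Tendsto (fun z => (τ z, ω z - w0)) (F : Filter (ℝ × ℝ)) (𝓝 (0, w0 - w0)) :=
      hτ0.prodMk_nhds (hωt.sub_const w0)
    rw [sub_self] at this
    exact this
  · exact hτpos
  · rw [Ultrafilter.coe_map, eventually_map]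
    filter_upwards [hΨ0] with z hz'
    simpa using hz'

theorem good_all (m : ℕ) : Good m := by
  induction m using Nat.strong_induction_on with
  | _ m IH =>
    intro Φ hΦ h3 F hF hFx hFz
    by_cases h2 : ∀ k < m, Ly^[k] Φ 0 = 0
    swap
    · push Not at h2
      obtain ⟨k, hk, hne⟩ := h2
      exact IH k hk Φ hΦ hne F hF hFx hFz
    have hΦ0 : Φ 0 = 0 := by
      have t1 : Tendsto Φ (F : Filter (ℝ × ℝ)) (𝓝 (Φ 0)) := hΦ.continuousAt.tendsto.mono_left hF
      have t2 : Tendsto Φ (F : Filter (ℝ × ℝ)) (𝓝 0) :=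
        tendsto_const_nhds.congr' (hFz.mono fun _ h => h.symm)
      exact tendsto_nhds_unique t1 t2
    rcases Nat.eq_zero_or_pos m with rfl | hm
    · exact absurd hΦ0 h3
    have hD := Ly_iter_analytic hΦ (m - 1)
    have hD1 : Ly (Ly^[m - 1] Φ) 0 ≠ 0 := by
      rw [← Function.iterate_succ_apply' Ly, Nat.succ_eq_add_one, Nat.sub_add_cancel hm]
      exact h3
    obtain ⟨α, hα, hα0, hαD⟩ := implicit_y hD (h2 (m - 1) (by omega)) hD1
    have hαfst : AnalyticAt ℝ (fun z : ℝ × ℝ => α z.1) 0 :=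
      AnalyticAt.fun_comp (g := α) (f := fun z : ℝ × ℝ => z.1) hα (by fun_prop)
    have hρ : AnalyticAt ℝ (fun z : ℝ × ℝ => (z.1, z.2 + α z.1)) 0 :=
      AnalyticAt.prod (by fun_prop) (AnalyticAt.fun_add (by fun_prop) hαfst)
    have hΦ1 : AnalyticAt ℝ (fun z : ℝ × ℝ => Φ (z.1, z.2 + α z.1)) 0 := by
      refine AnalyticAt.fun_comp (g := Φ) (f := fun z : ℝ × ℝ => (z.1, z.2 + α z.1)) ?_ hρ
      simp only [Prod.fst_zero, Prod.snd_zero, hα0, add_zero]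
      exact hΦ
    have hLy : ∀ᶠ x in 𝓝 (0 : ℝ), ∀ k, Ly^[k] (fun z : ℝ × ℝ => Φ (z.1, z.2 + α z.1)) (x, 0) =
        Ly^[k] Φ (x, α x) := by
      have ht : Tendsto (fun x : ℝ => (x, α x)) (𝓝 0) (𝓝 0) := by
        have : ContinuousAt (fun x : ℝ => (x, α x)) 0 :=
          continuousAt_id.prodMk hα.continuousAt
        have := this.tendsto
        simp only [hα0] at this
        exact this
      filter_upwards [eventually_axis hΦ1.eventually_analyticAt,
        ht.eventually hΦ.eventually_analyticAt] with x ha hb k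
      rw [← iteratedDeriv_slice ha, ← iteratedDeriv_slice hb]
      have h4 := congrFun (iteratedDeriv_comp_add_const k (fun y => Φ (x, y)) (α x)) 0
      simp only at h4 ⊢
      rw [h4, zero_add]
    have hLy0 : ∀ k, Ly^[k] (fun z : ℝ × ℝ => Φ (z.1, z.2 + α z.1)) 0 = Ly^[k] Φ 0 := by
      intro k
      have := hLy.self_of_nhds k
      rwa [hα0] at this
    refine transport (Ψ := fun z : ℝ × ℝ => Φ (z.1, z.2 + α z.1))
      (ρ := fun z : ℝ × ℝ => (z.1, z.2 + α z.1)) (θ := fun z => (z.1, z.2 - α z.1)) F hρ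
      (by simp [hα0]) (Eventually.of_forall fun z h => h) (Eventually.of_forall fun z => by simp)
      (step m hm IH _ hΦ1 ?_ ?_ ?_ _ ?_ ?_ ?_)
    · filter_upwards [hLy, hαD] with x ha hb
      rw [ha, hb]
    · intro k hk
      rw [hLy0, h2 k hk]
    · rwa [hLy0]
    · have hc : ContinuousAt (fun z : ℝ × ℝ => (z.1, z.2 - α z.1)) 0 :=
        continuousAt_fst.prodMk (continuousAt_snd.sub hαfst.continuousAt)
      have := hc.tendsto.mono_left hF
      simp only [Prod.fst_zero, Prod.snd_zero, hα0, sub_zero] at this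
      exact this
    · exact hFx
    · rw [Ultrafilter.coe_map, eventually_map]
      filter_upwards [hFz] with z hz
      simpa using hz


lemma rotated (Φ : ℝ × ℝ → ℝ) (hΦ : AnalyticAt ℝ Φ 0) (a b κ : ℝ) (hκ : κ * κ = 1)
    (hN : 0 < a ^ 2 + b ^ 2) (hφ : ¬ ∀ᶠ y in 𝓝 (0 : ℝ), Φ (y * a, y * b) = 0)
    (F : Ultrafilter (ℝ × ℝ)) (hF : (F : Filter (ℝ × ℝ)) ≤ 𝓝 0)
    (hFx : ∀ᶠ z in (F : Filter (ℝ × ℝ)), 0 < κ * (b * z.1 - a * z.2))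
    (hFz : ∀ᶠ z in (F : Filter (ℝ × ℝ)), Φ z = 0) :
    ∃ γ : ℝ → ℝ × ℝ, AnalyticAt ℝ γ 0 ∧ γ 0 = 0 ∧ (∀ᶠ τ in 𝓝 (0 : ℝ), Φ (γ τ) = 0) ∧
      (F : Filter (ℝ × ℝ)) ≤ map γ (𝓝[>] 0) := by
  set ρ : ℝ × ℝ → ℝ × ℝ := fun z => (κ * z.1 * b + z.2 * a, z.2 * b - κ * z.1 * a) with hρ
  have hρa : AnalyticAt ℝ ρ 0 := by
    simp only [hρ]
    have h1 : AnalyticAt ℝ (fun z : ℝ × ℝ => z.1) 0 := analyticAt_fst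
    have h2 : AnalyticAt ℝ (fun z : ℝ × ℝ => z.2) 0 := analyticAt_snd
    fun_prop
  have hρ0 : ρ 0 = 0 := by ext <;> simp [hρ]
  have hΨ : AnalyticAt ℝ (fun z => Φ (ρ z)) 0 := by
    refine AnalyticAt.fun_comp (g := Φ) (f := ρ) ?_ hρa
    rwa [hρ0]
  have hslice : (fun y : ℝ => Φ (ρ (0, y))) = fun y => Φ (y * a, y * b) := by
    funext y; simp [hρ]
  have hsa : AnalyticAt ℝ (fun y : ℝ => Φ (ρ (0, y))) 0 :=
    AnalyticAt.fun_comp (g := fun z => Φ (ρ z)) (f := fun y : ℝ => ((0 : ℝ), y)) hΨ (by fun_prop)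
  obtain ⟨m, hm⟩ : ∃ m, Ly^[m] (fun z => Φ (ρ z)) 0 ≠ 0 := by
    by_contra! hcon
    apply hφ
    have htop : analyticOrderAt (fun y : ℝ => Φ (ρ (0, y))) 0 = ⊤ := by
      refine ENat.eq_top_iff_forall_ge.2 fun n => ?_
      rw [natCast_le_analyticOrderAt_iff_iteratedDeriv_eq_zero hsa]
      intro i _
      rw [iteratedDeriv_slice (f := fun z => Φ (ρ z)) (x := 0) (y := 0) hΨ i]
      exact hcon i
    rw [hslice] at htop
    exact analyticOrderAt_eq_top.1 htop
  set θ : ℝ × ℝ → ℝ × ℝ := fun z =>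
    (κ * (b * z.1 - a * z.2) / (a ^ 2 + b ^ 2), (a * z.1 + b * z.2) / (a ^ 2 + b ^ 2)) with hθ
  have hid : ∀ z, ρ (θ z) = z := by
    intro z
    ext
    · simp only [hρ, hθ]
      field_simp
      linear_combination (b ^ 2 * z.1 - a * b * z.2) * hκ
    · simp only [hρ, hθ]
      field_simp
      linear_combination (a ^ 2 * z.2 - a * b * z.1) * hκ
  refine transport (Ψ := fun z => Φ (ρ z)) (θ := θ) F hρa hρ0 (Eventually.of_forall fun z h => h)
    (Eventually.of_forall hid) (good_all m _ hΨ hm _ ?_ ?_ ?_)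
  · have hc : Continuous θ := by simp only [hθ]; fun_prop
    have h0 : θ 0 = 0 := by ext <;> simp [hθ]
    have := (hc.tendsto 0).mono_left hF
    rw [h0] at this
    exact this
  · rw [Ultrafilter.coe_map, eventually_map]
    filter_upwards [hFx] with z hz
    exact div_pos hz hN
  · rw [Ultrafilter.coe_map, eventually_map]
    filter_upwards [hFz] with z hz
    rw [hid, hz]

/-- Let `Φ` be real analytic on a connected open neighborhood `V` of `0 ∈ ℝ²`,
with `Φ(0) = 0` and `Φ` not identically zero, and let `ζ_s ≠ 0` be zeros of `Φ`
with `ζ_s → 0`. Then, after passing to a subsequence, there are a real analytic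
curve `γ : (-ε, ε) → ℝ²` with `γ(0) = 0` lying in the zero set of `Φ`, and a
sequence `t_s > 0`, `t_s → 0`, with `γ(t_s) = ζ_s`. -/
theorem zeros_accumulating_lie_on_analytic_curve
    (V : Set (ℝ × ℝ)) (hV : IsOpen V) (hVconn : IsConnected V) (h0V : (0 : ℝ × ℝ) ∈ V)
    (Φ : ℝ × ℝ → ℝ) (hΦ : AnalyticOnNhd ℝ Φ V) (hΦ0 : Φ 0 = 0)
    (hΦne : ¬ ∀ z ∈ V, Φ z = 0)
    (ζ : ℕ → ℝ × ℝ) (hζV : ∀ s, ζ s ∈ V) (hζ0 : ∀ s, Φ (ζ s) = 0)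
    (hζne : ∀ s, ζ s ≠ 0) (hζlim : Tendsto ζ atTop (𝓝 0)) :
    ∃ (σ : ℕ → ℕ), StrictMono σ ∧
      ∃ (ε : ℝ) (γ : ℝ → ℝ × ℝ), 0 < ε ∧
        AnalyticOnNhd ℝ γ (Set.Ioo (-ε) ε) ∧ γ 0 = 0 ∧
        (∀ τ ∈ Set.Ioo (-ε) ε, γ τ ∈ V ∧ Φ (γ τ) = 0) ∧
        ∃ t : ℕ → ℝ, (∀ s, 0 < t s) ∧ Tendsto t atTop (𝓝 0) ∧
          (∀ s, t s ∈ Set.Ioo (-ε) ε ∧ γ (t s) = ζ (σ s)) := by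
  have hgerm : ¬ ∀ᶠ z in 𝓝 (0 : ℝ × ℝ), Φ z = 0 := by
    intro h
    exact hΦne (hΦ.eqOn_zero_of_preconnected_of_eventuallyEq_zero hVconn.isPreconnected h0V h)
  obtain ⟨r, hr, hrV⟩ := Metric.isOpen_iff.1 hV 0 h0V
  obtain ⟨v, hvr, hv⟩ : ∃ v ∈ Metric.ball (0 : ℝ × ℝ) r, Φ v ≠ 0 := by
    by_contra! hcon
    exact hgerm (by filter_upwards [Metric.ball_mem_nhds (0 : ℝ × ℝ) hr] using hcon)
  have hφ : ¬ ∀ᶠ y in 𝓝 (0 : ℝ), Φ (y * v.1, y * v.2) = 0 := by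
    intro h
    let S : Set ℝ := (LinearMap.toSpanSingleton ℝ (ℝ × ℝ) v) ⁻¹' Metric.ball (0 : ℝ × ℝ) r
    have hS : IsPreconnected S :=
      ((convex_ball (0 : ℝ × ℝ) r).linear_preimage _).isPreconnected
    have h0 : (0 : ℝ) ∈ S := by simp [S, hr]
    have h1 : (1 : ℝ) ∈ S := by simpa [S] using hvr
    have han : AnalyticOnNhd ℝ (fun y : ℝ => Φ (y * v.1, y * v.2)) S := by
      intro y hy
      refine AnalyticAt.fun_comp (g := Φ) (f := fun y : ℝ => (y * v.1, y * v.2)) ?_ (by fun_prop)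
      exact hΦ _ (hrV hy)
    have := han.eqOn_zero_of_preconnected_of_eventuallyEq_zero hS h0 h h1
    simp at this
    exact hv this
  have hN : 0 < v.1 ^ 2 + v.2 ^ 2 := by
    by_contra hcon
    have h1 : v.1 = 0 := by nlinarith [sq_nonneg v.1, sq_nonneg v.2]
    have h2 : v.2 = 0 := by nlinarith [sq_nonneg v.1, sq_nonneg v.2]
    exact hv (by rw [show v = 0 from Prod.ext h1 h2, hΦ0])
  have hΦa := hΦ 0 h0V
  let F : Ultrafilter (ℝ × ℝ) := (hyperfilter ℕ).map ζ
  have hF : (F : Filter (ℝ × ℝ)) ≤ 𝓝 0 := hζlim.mono_left Nat.hyperfilter_le_atTop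
  have hFz : ∀ᶠ z in (F : Filter (ℝ × ℝ)), Φ z = 0 :=
    eventually_map.2 (Eventually.of_forall hζ0)
  have hFne : ∀ᶠ z in (F : Filter (ℝ × ℝ)), z ≠ 0 :=
    eventually_map.2 (Eventually.of_forall hζne)
  obtain ⟨γ, hγa, hγ0, hγz, hγF⟩ : ∃ γ : ℝ → ℝ × ℝ, AnalyticAt ℝ γ 0 ∧ γ 0 = 0 ∧
      (∀ᶠ τ in 𝓝 (0 : ℝ), Φ (γ τ) = 0) ∧ (F : Filter (ℝ × ℝ)) ≤ map γ (𝓝[>] 0) := by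
    have htri : ∀ᶠ z in (F : Filter (ℝ × ℝ)), (0 < (1 : ℝ) * (v.2 * z.1 - v.1 * z.2) ∨
        0 < (-1 : ℝ) * (v.2 * z.1 - v.1 * z.2)) ∨ v.2 * z.1 - v.1 * z.2 = 0 := by
      refine Eventually.of_forall fun z => ?_
      rcases lt_trichotomy 0 (v.2 * z.1 - v.1 * z.2) with h | h | h
      · left; left; linarith
      · right; exact h.symm
      · left; right; linarith
    rw [Ultrafilter.eventually_or, Ultrafilter.eventually_or] at htri
    rcases htri with (h | h) | h
    · exact rotated Φ hΦa v.1 v.2 1 (by norm_num) hN hφ F hF h hFz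
    · exact rotated Φ hΦa v.1 v.2 (-1) (by norm_num) hN hφ F hF h hFz
    · exfalso
      have han : AnalyticAt ℝ (fun y : ℝ => Φ (y * v.1, y * v.2)) 0 := by
        refine AnalyticAt.fun_comp (g := Φ) (f := fun y : ℝ => (y * v.1, y * v.2)) ?_ (by fun_prop)
        simp only [zero_mul]
        exact hΦa
      have hne := han.eventually_eq_zero_or_eventually_ne_zero.resolve_left hφ
      rw [eventually_nhdsWithin_iff] at hne
      have ht : Tendsto (fun z : ℝ × ℝ => (v.1 * z.1 + v.2 * z.2) / (v.1 ^ 2 + v.2 ^ 2))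
          (F : Filter (ℝ × ℝ)) (𝓝 0) := by
        have hc : Continuous (fun z : ℝ × ℝ => (v.1 * z.1 + v.2 * z.2) / (v.1 ^ 2 + v.2 ^ 2)) := by
          fun_prop
        have := (hc.tendsto 0).mono_left hF
        simpa using this
      have hfalse : ∀ᶠ _z in (F : Filter (ℝ × ℝ)), False := by
        filter_upwards [ht.eventually hne, h, hFz, hFne] with z h1 h2 h3 h4
        have e1 : (v.1 * z.1 + v.2 * z.2) / (v.1 ^ 2 + v.2 ^ 2) * v.1 = z.1 := by
          field_simp
          linear_combination (-v.2) * h2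
        have e2 : (v.1 * z.1 + v.2 * z.2) / (v.1 ^ 2 + v.2 ^ 2) * v.2 = z.2 := by
          field_simp
          linear_combination v.1 * h2
        rw [e1, e2] at h1
        refine h1 ?_ h3
        intro h0
        rw [mem_singleton_iff] at h0
        rw [h0, zero_mul] at e1 e2
        exact h4 (Prod.ext e1.symm e2.symm)
      exact (hfalse.exists).elim fun _ h => h
  have hγV : ∀ᶠ τ in 𝓝 (0 : ℝ), γ τ ∈ V := by
    have := hγa.continuousAt.tendsto
    rw [hγ0] at this
    exact this.eventually (hV.mem_nhds h0V)
  obtain ⟨ε, hε, hball⟩ := Metric.eventually_nhds_iff_ball.1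
    (hγa.eventually_analyticAt.and (hγV.and hγz))
  have hIoo : ∀ τ ∈ Set.Ioo (-ε) ε, τ ∈ Metric.ball (0 : ℝ) ε := by
    intro τ hτ
    rw [Real.ball_eq_Ioo]
    simpa using hτ
  have hfreq : ∀ n : ℕ, ∃ᶠ k in atTop, ∃ t : ℝ, 0 < t ∧ t < min ε (1 / ((n : ℝ) + 1)) ∧
      γ t = ζ k := by
    intro n
    have hδ : 0 < min ε (1 / ((n : ℝ) + 1)) := lt_min hε (by positivity)
    have hmem : γ '' Set.Ioo 0 (min ε (1 / ((n : ℝ) + 1))) ∈ (F : Filter (ℝ × ℝ)) :=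
      hγF (image_mem_map (Ioo_mem_nhdsGT hδ))
    have hev : ∀ᶠ k in (hyperfilter ℕ : Filter ℕ), ∃ t : ℝ, 0 < t ∧
        t < min ε (1 / ((n : ℝ) + 1)) ∧ γ t = ζ k := by
      have h1 : ∀ᶠ k in (hyperfilter ℕ : Filter ℕ),
          ζ k ∈ γ '' Set.Ioo 0 (min ε (1 / ((n : ℝ) + 1))) := hmem
      filter_upwards [h1] with k hk
      obtain ⟨t, ht, htk⟩ := hk
      exact ⟨t, ht.1, ht.2, htk⟩
    exact hev.frequently.filter_mono Nat.hyperfilter_le_atTop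
  obtain ⟨σ, hσ, hσt⟩ := extraction_forall_of_frequently hfreq
  choose t ht0 ht1 ht2 using hσt
  refine ⟨σ, hσ, ε, γ, hε, fun τ hτ => (hball τ (hIoo τ hτ)).1, hγ0,
    fun τ hτ => (hball τ (hIoo τ hτ)).2, t, ht0, ?_, fun s => ⟨⟨?_, ?_⟩, ht2 s⟩⟩
  · refine squeeze_zero (fun s => (ht0 s).le)
      (fun s => ((ht1 s).trans_le (min_le_right _ _)).le) ?_
    exact tendsto_one_div_add_atTop_nhds_zero_nat
  · linarith [ht0 s]
  · exact (ht1 s).trans_le (min_le_left _ _)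
end
end
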